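/- Let σ = 1, let A be an index set, and for each a ∈ A let K_a = K_a(y) ∈ L₀ be a kernel independent of (t,x) (satisfying the cancellation condition ∫_{∂B_r} y K_a(y) dS(y) = 0 for every r > 0), and f_a : ℝ₀^{d+1} → ℝ with sup_{a∈A} ‖f_a‖_{L∞(ℝ₀^{d+1})} < ∞. Suppose u : ℝ₀^{d+1} → ℝ is smooth, δu(t,x,·) is integrable against |y|^{−d−1}, u satisfies ∂_t u = inf_{a∈A}(L_a u + f_a) pointwise in ℝ₀^{d+1}, and [u]_{Λ¹(ℝ₀^{d+1})} is finite. Then [u]_{Λ¹(ℝ₀^{d+1})} ≤ C·sup_{a∈A} ‖f_a‖_{L∞(ℝ₀^{d+1})}, where C depends only on d, λ, and Λ. -/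

import Mathlib

open MeasureTheory Set Metric ENNReal
open scoped Classical
noncomputable section

namespace Nonlocal

variable {d : ℕ}

/-- `d`-dimensional Euclidean space. -/
abbrev E (d : ℕ) : Type := EuclideanSpace ℝ (Fin d)

/-- The parabolic cylinder `Q_r(t,x) = (t - r^σ, t) × B_r(x)`. -/
def Q (σ r t : ℝ) (x : E d) : Set (ℝ × E d) := Ioo (t - r ^ σ) t ×ˢ ball x r

/-- `Q_r = Q_r(0,0)`. -/
def Q0 (d : ℕ) (σ r : ℝ) : Set (ℝ × E d) := Q σ r 0 (0 : E d)

/-- The lower half space `ℝ₀^{d+1} = (-∞,0) × ℝ^d`. -/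
def lowerHalf (d : ℕ) : Set (ℝ × E d) := Iio (0 : ℝ) ×ˢ (univ : Set (E d))

/-- The spatial differential `Du`. -/
def Du (u : ℝ × E d → ℝ) (z : ℝ × E d) : E d →L[ℝ] ℝ :=
  fderiv ℝ (fun x => u (z.1, x)) z.2

/-- The time derivative `∂_t u`. -/
def ut (u : ℝ × E d → ℝ) (z : ℝ × E d) : ℝ :=
  deriv (fun s => u (s, z.2)) z.1

/-- The increment `δu(t,x,y)`, whose form depends on the order `σ`. -/
def deltaU (σ : ℝ) (u : ℝ × E d → ℝ) (t : ℝ) (x y : E d) : ℝ :=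
  u (t, x + y) - u (t, x) -
    (if 1 < σ then Du u (t, x) y
      else if σ = 1 then (if ‖y‖ < 1 then Du u (t, x) y else 0) else 0)

/-- Ellipticity bounds `λ(2-σ)|y|^{-d-σ} ≤ K(y) ≤ Λ(2-σ)|y|^{-d-σ}`. -/
def kernelBounds (σ lam Lam : ℝ) (K : E d → ℝ) : Prop :=
  ∀ y : E d, y ≠ 0 →
    lam * (2 - σ) * ‖y‖ ^ (-((d : ℝ) + σ)) ≤ K y ∧
      K y ≤ Lam * (2 - σ) * ‖y‖ ^ (-((d : ℝ) + σ))

/-- Cancellation condition `∫_{∂B_r} y K(y) dS(y) = 0` for all `r > 0`,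
formulated equivalently via vanishing of the integrals over all annuli. -/
def cancels (K : E d → ℝ) : Prop :=
  ∀ r₁ r₂ : ℝ, 0 < r₁ → r₁ < r₂ →
    (∫ y in {y : E d | r₁ ≤ ‖y‖ ∧ ‖y‖ ≤ r₂}, K y • y) = 0

/-- Membership in the class `L₀`. -/
def memL0 (σ lam Lam : ℝ) (K : E d → ℝ) : Prop :=
  kernelBounds σ lam Lam K ∧ (σ = 1 → cancels K)

/-- The nonlocal operator `L u(t,x) = ∫ δu(t,x,y) K(y) dy` (translation invariant kernel). -/
def Lop (σ : ℝ) (K : E d → ℝ) (u : ℝ × E d → ℝ) (z : ℝ × E d) : ℝ :=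
  ∫ y, deltaU σ u z.1 z.2 y * K y

/-- The nonlocal operator with `(t,x)`-dependent kernel. -/
def LopTX (σ : ℝ) (K : ℝ × E d → E d → ℝ) (u : ℝ × E d → ℝ) (z : ℝ × E d) : ℝ :=
  ∫ y, deltaU σ u z.1 z.2 y * K z y

/-- The maximal Pucci extremal operator `M⁺`. -/
def Mplus (σ lam Lam : ℝ) (u : ℝ × E d → ℝ) (z : ℝ × E d) : ℝ :=
  if σ = 1 then sSup {v | ∃ K : E d → ℝ, memL0 1 lam Lam K ∧ v = Lop 1 K u z}
  else ∫ y, (Lam * max (deltaU σ u z.1 z.2 y) 0 - lam * max (-deltaU σ u z.1 z.2 y) 0) *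
      ((2 - σ) * ‖y‖ ^ (-((d : ℝ) + σ)))

/-- The minimal Pucci extremal operator `M⁻`. -/
def Mminus (σ lam Lam : ℝ) (u : ℝ × E d → ℝ) (z : ℝ × E d) : ℝ :=
  if σ = 1 then sInf {v | ∃ K : E d → ℝ, memL0 1 lam Lam K ∧ v = Lop 1 K u z}
  else ∫ y, (lam * max (deltaU σ u z.1 z.2 y) 0 - Lam * max (-deltaU σ u z.1 z.2 y) 0) *
      ((2 - σ) * ‖y‖ ^ (-((d : ℝ) + σ)))

variable {F : Type*} [NormedAddCommGroup F]

/-- The parabolic Hölder seminorm `[f]_{β,α;Ω}` (exponent `β` in time and `α` in space). -/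
def holderE (β α : ℝ) (Ω : Set (ℝ × E d)) (f : ℝ × E d → F) : ℝ≥0∞ :=
  ⨆ (p : Ω) (q : Ω), ENNReal.ofReal
    (‖f p.1 - f q.1‖ / max (‖p.1.2 - q.1.2‖ ^ α) (|p.1.1 - q.1.1| ^ β))

/-- The sup norm `‖f‖_{L∞(Ω)}`. -/
def supENorm (Ω : Set (ℝ × E d)) (f : ℝ × E d → F) : ℝ≥0∞ :=
  ⨆ p : Ω, ENNReal.ofReal ‖f p.1‖

/-- The full Hölder norm `‖f‖_{β,α;Ω}`. -/
def pnormE (β α : ℝ) (Ω : Set (ℝ × E d)) (f : ℝ × E d → ℝ) : ℝ≥0∞ :=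
  supENorm Ω f + holderE β α Ω f

/-- The seminorm `[u]_{1+α/σ, σ+α; Ω} = [D^ν u]_{α/σ, σ+α-ν; Ω} + [∂_t u]_{α/σ, σ+α-ν; Ω}`
with `ν = ⌊σ+α⌋`. -/
def parab2Semi (σ α : ℝ) (Ω : Set (ℝ × E d)) (u : ℝ × E d → ℝ) : ℝ≥0∞ :=
  holderE (α / σ) (σ + α - (⌊σ + α⌋₊ : ℝ)) Ω
      (fun z => iteratedFDeriv ℝ ⌊σ + α⌋₊ (fun x => u (z.1, x)) z.2)
    + holderE (α / σ) (σ + α - (⌊σ + α⌋₊ : ℝ)) Ω (fun z => ut u z)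

/-- General parabolic seminorm `[u]_{β/σ, β; Ω}` of order `β ≥ 0` (sup norm for `β = 0`);
a time-derivative term appears when `β > σ`. -/
def pSemiGen (σ β : ℝ) (Ω : Set (ℝ × E d)) (u : ℝ × E d → ℝ) : ℝ≥0∞ :=
  if β = 0 then supENorm Ω u
  else
    holderE (if σ < β then (β - σ) / σ else β / σ) (β - ((⌈β⌉₊ : ℝ) - 1)) Ω
        (fun z => iteratedFDeriv ℝ (⌈β⌉₊ - 1) (fun x => u (z.1, x)) z.2)
      + (if σ < β then
          holderE ((β - σ) / σ) (β - ((⌈β⌉₊ : ℝ) - 1)) Ω (fun z => ut u z) else 0)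

/-- Hölder seminorm in `x` only: `[f]^*_{β;Ω}`. -/
def holderX (β : ℝ) (Ω : Set (ℝ × E d)) (f : ℝ × E d → F) : ℝ≥0∞ :=
  ⨆ (t : ℝ) (x : E d) (y : E d) (_ : (t, x) ∈ Ω) (_ : (t, y) ∈ Ω),
    ENNReal.ofReal (‖f (t, x) - f (t, y)‖ / ‖x - y‖ ^ β)

/-- Hölder seminorm in `t` only: `[f]^t_{β;Ω}`. -/
def holderT (β : ℝ) (Ω : Set (ℝ × E d)) (f : ℝ × E d → F) : ℝ≥0∞ :=
  ⨆ (t : ℝ) (s : ℝ) (x : E d) (_ : (t, x) ∈ Ω) (_ : (s, x) ∈ Ω),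
    ENNReal.ofReal (‖f (t, x) - f (s, x)‖ / |t - s| ^ β)

/-- Zygmund seminorm in `t` only: `[u]^t_{Λ¹(Ω)}`. -/
def zygT (Ω : Set (ℝ × E d)) (u : ℝ × E d → ℝ) : ℝ≥0∞ :=
  ⨆ (t : ℝ) (x : E d) (h : ℝ) (_ : 0 < h) (_ : (t, x) ∈ Ω) (_ : (t + h, x) ∈ Ω)
    (_ : (t - h, x) ∈ Ω),
    ENNReal.ofReal (|u (t + h, x) + u (t - h, x) - 2 * u (t, x)| / h)

/-- Zygmund seminorm in `(t,x)`: `[u]_{Λ¹(Ω)}`. -/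
def zygFull (Ω : Set (ℝ × E d)) (u : ℝ × E d → ℝ) : ℝ≥0∞ :=
  ⨆ (z : ℝ × E d) (h : ℝ × E d) (_ : h ≠ 0) (_ : z ∈ Ω) (_ : z + h ∈ Ω) (_ : z - h ∈ Ω),
    ENNReal.ofReal (|u (z + h) + u (z - h) - 2 * u z| / ‖h‖)

/-- The function `P(t,x)` of Lemma 3.3. -/
def Pfun (σ : ℝ) (u : ℝ × E d → ℝ) (z : ℝ × E d) : ℝ :=
  ∫ y, max (deltaU σ u z.1 z.2 y - deltaU σ u 0 (0 : E d) y) 0 *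
    ((2 - σ) * ‖y‖ ^ (-((d : ℝ) + σ)))

/-- The function `N(t,x)` of Lemma 3.3. -/
def Nfun (σ : ℝ) (u : ℝ × E d → ℝ) (z : ℝ × E d) : ℝ :=
  ∫ y, max (-(deltaU σ u z.1 z.2 y - deltaU σ u 0 (0 : E d) y)) 0 *
    ((2 - σ) * ‖y‖ ^ (-((d : ℝ) + σ)))

/-- Mollification of `u` in the time variable: `u^{(R)}`. -/
def tmoll (σ R : ℝ) (η : ℝ → ℝ) (u : ℝ × E d → ℝ) : ℝ × E d → ℝ :=
  fun z => ∫ s : ℝ, (2 * u (z.1 - R ^ σ * s, z.2) - u (z.1 - 2 * R ^ σ * s, z.2)) * η (s - 1)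

/-- First-order Taylor expansion of `u^{(R)}` at the origin. -/
def tmollTaylor (σ R : ℝ) (η : ℝ → ℝ) (u : ℝ × E d → ℝ) : ℝ × E d → ℝ :=
  fun z => tmoll σ R η u (0, 0)
    + z.1 * derivWithin (fun s => tmoll σ R η u (s, (0 : E d))) (Iio (0 : ℝ)) 0
    + fderiv ℝ (fun x => tmoll σ R η u ((0 : ℝ), x)) 0 z.2

/-- Mollification of `u` in space-time (case `σ = 1`). -/
def stmoll (R : ℝ) (η : ℝ → ℝ) (ζ : E d → ℝ) (u : ℝ × E d → ℝ) : ℝ × E d → ℝ :=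
  fun z => ∫ w : ℝ × E d,
    (2 * u (z.1 - R * w.1, z.2 - R • w.2) - u (z.1 - 2 * R * w.1, z.2 - R • w.2)) *
      (η (w.1 - 1) * ζ w.2)

/-- First-order Taylor expansion of the space-time mollification at the origin. -/
def stmollTaylor (R : ℝ) (η : ℝ → ℝ) (ζ : E d → ℝ) (u : ℝ × E d → ℝ) : ℝ × E d → ℝ :=
  fun z => stmoll R η ζ u (0, 0)
    + z.1 * derivWithin (fun s => stmoll R η ζ u (s, (0 : E d))) (Iio (0 : ℝ)) 0
    + fderiv ℝ (fun x => stmoll R η ζ u ((0 : ℝ), x)) 0 z.2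

end Nonlocal
open MeasureTheory Set Metric ENNReal Nonlocal

namespace Nonlocal

variable {d : ℕ}

/-- The measurable kernels of the class `L₀` of order one. -/
def IsKer (lam Lam : ℝ) (K : E d → ℝ) : Prop := Measurable K ∧ memL0 1 lam Lam K

theorem nontrivial_E (hd : 1 ≤ d) : Nontrivial (E d) := by
  have : Nonempty (Fin d) := ⟨⟨0, hd⟩⟩
  infer_instance

theorem IsKer.lower {lam Lam : ℝ} {K : E d → ℝ} (hK : IsKer lam Lam K) {y : E d} (hy : y ≠ 0) :
    lam * ‖y‖ ^ (-((d : ℝ) + 1)) ≤ K y := by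
  have := (hK.2.1 y hy).1
  norm_num at this ⊢
  exact this

theorem IsKer.upper {lam Lam : ℝ} {K : E d → ℝ} (hK : IsKer lam Lam K) {y : E d} (hy : y ≠ 0) :
    K y ≤ Lam * ‖y‖ ^ (-((d : ℝ) + 1)) := by
  have := (hK.2.1 y hy).2
  norm_num at this ⊢
  exact this

theorem IsKer.nonneg {lam Lam : ℝ} (hlam : 0 < lam) {K : E d → ℝ} (hK : IsKer lam Lam K) {y : E d}
    (hy : y ≠ 0) : 0 ≤ K y :=
  le_trans (by positivity) (hK.lower hy)

/-- An integrable radial weight which is quadratic against the singularity `|y|^{-d-1}` and grows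
like a square root against its tail. -/
def wt (y : E d) : ℝ :=
  (if ‖y‖ < 1 then ‖y‖ ^ 2 else 2 * ‖y‖ ^ (1 / 2 : ℝ)) * ‖y‖ ^ (-((d : ℝ) + 1))

theorem wt_nonneg (y : E d) : 0 ≤ wt y := by
  unfold wt
  split_ifs <;> positivity

theorem integrable_wt (hd : 1 ≤ d) : Integrable (wt (d := d)) := by
  have := nontrivial_E hd
  have key := (integrable_fun_norm_addHaar (volume : Measure (E d))
    (f := fun r : ℝ => (if r < 1 then r ^ 2 else 2 * r ^ (1 / 2 : ℝ)) * r ^ (-((d : ℝ) + 1)))).2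
  refine key ?_
  rw [finrank_euclideanSpace_fin, ← Ioc_union_Ioi_eq_Ioi zero_le_one]
  have pow_eq : ∀ r : ℝ, 0 < r → r ^ (d - 1) = r ^ ((d : ℝ) - 1) := by
    intro r hr
    rw [← Real.rpow_natCast, Nat.cast_sub hd, Nat.cast_one]
  refine IntegrableOn.union ?_ ?_
  · rw [integrableOn_Ioc_iff_integrableOn_Ioo]
    refine IntegrableOn.congr_fun (f := fun _ => (1 : ℝ)) (by simp) ?_ measurableSet_Ioo
    intro r hr
    have h0 : (0 : ℝ) < r := hr.1
    simp only [hr.2, if_true, smul_eq_mul, pow_eq r h0]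
    rw [← Real.rpow_natCast r 2, ← Real.rpow_add h0, ← Real.rpow_add h0]
    have h2 : (d : ℝ) - 1 + (((2 : ℕ) : ℝ) + -((d : ℝ) + 1)) = 0 := by push_cast; ring
    rw [h2, Real.rpow_zero]
  · have h := (integrableOn_Ioi_rpow_of_lt (a := (-3 / 2 : ℝ)) (c := 1) (by norm_num)
      one_pos).const_mul 2
    refine IntegrableOn.congr_fun h ?_ measurableSet_Ioi
    intro r hr
    have h1 : (1 : ℝ) < r := hr
    have h0 : (0 : ℝ) < r := by linarith
    simp only [not_lt.2 h1.le, if_false, smul_eq_mul, pow_eq r h0]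
    rw [mul_assoc 2, ← Real.rpow_add h0, mul_left_comm, ← Real.rpow_add h0]
    congr 2
    ring

theorem measurableSet_far (ρ : ℝ) : MeasurableSet {y : E d | ρ ≤ ‖y‖} :=
  measurableSet_le measurable_const measurable_norm

theorem norm_pos_of_far {ρ : ℝ} (hρ : 0 < ρ) {y : E d} (hy : ρ ≤ ‖y‖) : y ≠ 0 :=
  norm_pos_iff.1 (hρ.trans_le hy)

theorem IsKer.le_wt {lam Lam : ℝ} (hlam : 0 < lam) (hlL : lam ≤ Lam) {K : E d → ℝ}
    (hK : IsKer lam Lam K) {ρ : ℝ} (hρ : 0 < ρ) {y : E d} (hy : ρ ≤ ‖y‖) :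
    (1 + ‖y‖ ^ (1 / 2 : ℝ)) * K y ≤ Lam * (2 / ρ ^ 2 + 1) * wt y := by
  have hy0 := norm_pos_of_far hρ hy
  have hLam : 0 < Lam := by linarith
  have h1 := hK.upper hy0
  have h2 : 1 + ‖y‖ ^ (1 / 2 : ℝ)
      ≤ (2 / ρ ^ 2 + 1) * (if ‖y‖ < 1 then ‖y‖ ^ 2 else 2 * ‖y‖ ^ (1 / 2 : ℝ)) := by
    split_ifs with h
    · have h3 : ‖y‖ ^ (1 / 2 : ℝ) ≤ 1 := Real.rpow_le_one (norm_nonneg _) h.le (by norm_num)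
      have h4 : ρ ^ 2 ≤ ‖y‖ ^ 2 := by gcongr
      have h5 : 2 ≤ 2 / ρ ^ 2 * ‖y‖ ^ 2 := by
        rw [div_mul_eq_mul_div, le_div_iff₀ (by positivity)]; linarith
      nlinarith [sq_nonneg ‖y‖]
    · have h3 : 1 ≤ ‖y‖ ^ (1 / 2 : ℝ) := Real.one_le_rpow (not_lt.1 h) (by norm_num)
      have h5 : 0 ≤ 2 / ρ ^ 2 := by positivity
      nlinarith
  have h6 : 0 ≤ ‖y‖ ^ (1 / 2 : ℝ) := by positivity
  calc (1 + ‖y‖ ^ (1 / 2 : ℝ)) * K y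
      ≤ (1 + ‖y‖ ^ (1 / 2 : ℝ)) * (Lam * ‖y‖ ^ (-((d : ℝ) + 1))) := by gcongr
    _ ≤ ((2 / ρ ^ 2 + 1) * (if ‖y‖ < 1 then ‖y‖ ^ 2 else 2 * ‖y‖ ^ (1 / 2 : ℝ))) *
        (Lam * ‖y‖ ^ (-((d : ℝ) + 1))) := by gcongr
    _ = Lam * (2 / ρ ^ 2 + 1) * wt y := by unfold wt; ring

theorem IsKer.integrableOn_far (hd : 1 ≤ d) {lam Lam : ℝ} (hlam : 0 < lam) (hlL : lam ≤ Lam)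
    {K : E d → ℝ} (hK : IsKer lam Lam K) {ρ : ℝ} (hρ : 0 < ρ) {f : E d → ℝ} (hf : Measurable f)
    {C : ℝ} (hC : ∀ y, |f y| ≤ C * (1 + ‖y‖ ^ (1 / 2 : ℝ))) :
    IntegrableOn (fun y => f y * K y) {y | ρ ≤ ‖y‖} := by
  have hC0 : 0 ≤ C := by
    have := (abs_nonneg _).trans (hC 0)
    simpa using this
  refine Integrable.mono' (((integrable_wt hd).const_mul (C * (Lam * (2 / ρ ^ 2 + 1)))).restrict)
    (hf.mul hK.1).aestronglyMeasurable ?_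
  filter_upwards [ae_restrict_mem (measurableSet_far ρ)] with y hy
  have hy0 := norm_pos_of_far hρ hy
  rw [Real.norm_eq_abs, abs_mul, abs_of_nonneg (hK.nonneg hlam hy0)]
  calc |f y| * K y ≤ (C * (1 + ‖y‖ ^ (1 / 2 : ℝ))) * K y :=
        mul_le_mul_of_nonneg_right (hC y) (hK.nonneg hlam hy0)
    _ = C * ((1 + ‖y‖ ^ (1 / 2 : ℝ)) * K y) := by ring
    _ ≤ C * (Lam * (2 / ρ ^ 2 + 1) * wt y) :=
        mul_le_mul_of_nonneg_left (hK.le_wt hlam hlL hρ hy) hC0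
    _ = C * (Lam * (2 / ρ ^ 2 + 1)) * wt y := by ring

theorem IsKer.annulus (hd : 1 ≤ d) {lam Lam : ℝ} (hlam : 0 < lam) (hlL : lam ≤ Lam)
    {K : E d → ℝ} (hK : IsKer lam Lam K) {ρ : ℝ} (hρ : 0 < ρ) (hρ1 : ρ < 1) (l : E d →L[ℝ] ℝ) :
    IntegrableOn (fun y => (if ‖y‖ < 1 then l y else 0) * K y) {y | ρ ≤ ‖y‖} ∧
      ∫ y in {y | ρ ≤ ‖y‖}, (if ‖y‖ < 1 then l y else 0) * K y = 0 := by
  have := nontrivial_E hd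
  have hm1 : MeasurableSet {y : E d | ‖y‖ < 1} := measurableSet_lt measurable_norm measurable_const
  have hm2 : MeasurableSet {y : E d | ‖y‖ ≤ 1} := measurableSet_le measurable_norm measurable_const
  have hint : ∀ l : E d →L[ℝ] ℝ,
      IntegrableOn (fun y => (if ‖y‖ < 1 then l y else 0) * K y) {y | ρ ≤ ‖y‖} := by
    intro l
    refine hK.integrableOn_far hd hlam hlL hρ
      (Measurable.ite hm1 l.continuous.measurable measurable_const) (C := ‖l‖) ?_
    intro y
    have h6 : 0 ≤ ‖y‖ ^ (1 / 2 : ℝ) := by positivity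
    split_ifs with h
    · have := l.le_opNorm y
      rw [Real.norm_eq_abs] at this
      refine this.trans ?_
      gcongr
      linarith
    · simp only [abs_zero]; positivity
  refine ⟨hint l, ?_⟩
  have hKint : IntegrableOn (fun y => K y • y) {y : E d | ρ ≤ ‖y‖ ∧ ‖y‖ ≤ 1} := by
    have h1 := hK.integrableOn_far hd hlam hlL hρ (f := fun y => if ‖y‖ ≤ 1 then ‖y‖ else 0)
      (Measurable.ite hm2 measurable_norm measurable_const) (C := 1) (by
        intro y
        have h6 : 0 ≤ ‖y‖ ^ (1 / 2 : ℝ) := by positivity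
        split_ifs with h
        · rw [abs_of_nonneg (norm_nonneg _)]; linarith
        · simp only [abs_zero]; positivity)
    refine Integrable.mono' (h1.mono_set (fun y hy => hy.1))
      (hK.1.smul measurable_id).aestronglyMeasurable ?_
    filter_upwards [ae_restrict_mem ((measurableSet_far ρ).inter hm2)] with y hy
    have hy2 : ‖y‖ ≤ 1 := hy.2
    rw [norm_smul, Real.norm_eq_abs, abs_of_nonneg (hK.nonneg hlam (norm_pos_of_far hρ hy.1))]
    simp only [hy2, if_true]
    exact (mul_comm _ _).le
  have hz := hK.2.2 rfl ρ 1 hρ hρ1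
  have hz2 : ∫ y in {y : E d | ρ ≤ ‖y‖ ∧ ‖y‖ ≤ 1}, l (K y • y) = 0 := by
    rw [ContinuousLinearMap.integral_comp_comm l hKint, hz, map_zero]
  have hinter : {y : E d | ρ ≤ ‖y‖ ∧ ‖y‖ ≤ 1} = {y : E d | ρ ≤ ‖y‖} ∩ {y : E d | ‖y‖ ≤ 1} := rfl
  rw [hinter, ← setIntegral_indicator hm2] at hz2
  refine Eq.trans ?_ hz2
  refine integral_congr_ae (ae_restrict_of_ae ?_)
  have hs : ∀ᵐ y : E d, y ∉ sphere (0 : E d) 1 :=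
    compl_mem_ae_iff.2 (Measure.addHaar_sphere volume (0 : E d) 1)
  filter_upwards [hs] with y hy
  have hy1 : ‖y‖ ≠ 1 := by simpa using hy
  by_cases h : ‖y‖ < 1
  · simp [h, h.le, indicator, mul_comm]
  · have h' : ¬ ‖y‖ ≤ 1 := fun h' => h (lt_of_le_of_ne h' hy1)
    simp [h, h', indicator]

theorem IsKer.setIntegral_le (hd : 1 ≤ d) {lam Lam : ℝ} (hlam : 0 < lam) (hlL : lam ≤ Lam)
    {K : E d → ℝ} (hK : IsKer lam Lam K) {ρ : ℝ} (hρ : 0 < ρ) (hρ1 : ρ < 1) (l : E d →L[ℝ] ℝ)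
    {a : ℝ} (ha : 0 ≤ a) {g : E d → ℝ}
    (hg : IntegrableOn (fun y => g y * K y) {y | ρ ≤ ‖y‖})
    (hnear : ∀ y, ‖y‖ < 1 → g y ≤ l y + a * ‖y‖ ^ 2)
    (hfar : ∀ y, 1 ≤ ‖y‖ → g y ≤ a * (2 * ‖y‖ ^ (1 / 2 : ℝ))) :
    ∫ y in {y | ρ ≤ ‖y‖}, g y * K y ≤ a * (Lam * ∫ y : E d, wt y) := by
  have hLam : 0 < Lam := by linarith
  obtain ⟨hi, h0⟩ := hK.annulus hd hlam hlL hρ hρ1 l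
  have hw := (integrable_wt hd).const_mul (a * Lam)
  calc ∫ y in {y | ρ ≤ ‖y‖}, g y * K y
      ≤ ∫ y in {y | ρ ≤ ‖y‖}, ((if ‖y‖ < 1 then l y else 0) * K y + a * Lam * wt y) := by
        refine setIntegral_mono_on hg (hi.add hw.integrableOn) (measurableSet_far ρ) ?_
        intro y hy
        have hy0 := norm_pos_of_far hρ hy
        have hKn := hK.nonneg hlam hy0
        have hKu := hK.upper hy0
        by_cases h : ‖y‖ < 1
        · simp only [h, if_true, wt]
          have h1 := mul_le_mul_of_nonneg_right (hnear y h) hKn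
          have h2 := mul_le_mul_of_nonneg_left hKu (by positivity : 0 ≤ a * ‖y‖ ^ 2)
          linarith
        · simp only [h, if_false, wt]
          have h1 := mul_le_mul_of_nonneg_right (hfar y (not_lt.1 h)) hKn
          have h2 := mul_le_mul_of_nonneg_left hKu
            (by positivity : 0 ≤ a * (2 * ‖y‖ ^ (1 / 2 : ℝ)))
          linarith
    _ = a * Lam * ∫ y in {y | ρ ≤ ‖y‖}, wt y := by
        rw [integral_add hi hw.integrableOn, h0, integral_const_mul, zero_add]
    _ ≤ a * Lam * ∫ y : E d, wt y := by
        refine mul_le_mul_of_nonneg_left ?_ (by positivity)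
        exact setIntegral_le_integral (integrable_wt hd) (Filter.Eventually.of_forall wt_nonneg)
    _ = _ := by ring

end Nonlocal

namespace Nonlocal

variable {d : ℕ}

/-- A smooth function growing like a square root at infinity. -/
def psi (x : E d) : ℝ := √√(1 + ‖x‖ ^ 2)

/-- The Gaussian bump. -/
def bump (x : E d) : ℝ := Real.exp (-‖x‖ ^ 2)

theorem continuous_psi : Continuous (psi (d := d)) := by unfold psi; fun_prop

theorem continuous_bump : Continuous (bump (d := d)) := by unfold bump; fun_prop

theorem bump_pos (x : E d) : 0 < bump x := Real.exp_pos _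

theorem bump_le_one (x : E d) : bump x ≤ 1 := by
  unfold bump
  rw [Real.exp_le_one_iff]
  simp

theorem psi_pow_four (x : E d) : psi x ^ 4 = 1 + ‖x‖ ^ 2 := by
  have h : psi x ^ 4 = ((psi x) ^ 2) ^ 2 := by ring
  rw [h, psi, Real.sq_sqrt (Real.sqrt_nonneg _), Real.sq_sqrt (by positivity)]

theorem one_le_psi (x : E d) : 1 ≤ psi x := by
  unfold psi
  rw [Real.one_le_sqrt, Real.one_le_sqrt]
  nlinarith [sq_nonneg ‖x‖]

theorem sqrt_norm_le_psi (x : E d) : √‖x‖ ≤ psi x := by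
  refine Real.sqrt_le_sqrt (Real.le_sqrt_of_sq_le ?_)
  linarith

theorem psi_le_two {x : E d} (hx : ‖x‖ ≤ 1) : psi x ≤ 2 := by
  have h := psi_pow_four x
  have h1 := one_le_psi x
  by_contra! h2
  have h3 : (2 : ℝ) ^ 4 < psi x ^ 4 := by gcongr
  nlinarith [norm_nonneg x]

theorem psi_near (x : E d) : ∃ a : ℝ, 0 ≤ a ∧ a ≤ 1 ∧
    ∀ y, psi (x + y) - psi x ≤ a * (2 * inner ℝ x y + ‖y‖ ^ 2) := by
  have h1 := one_le_psi x
  have h3 : 1 ≤ psi x ^ 3 := one_le_pow₀ h1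
  refine ⟨1 / (4 * psi x ^ 3), by positivity, ?_, fun y => ?_⟩
  · rw [div_le_one (by positivity)]; linarith
  · have h2 : 2 * inner ℝ x y + ‖y‖ ^ 2 = psi (x + y) ^ 4 - psi x ^ 4 := by
      rw [psi_pow_four, psi_pow_four, norm_add_sq_real]; ring
    rw [h2, one_div_mul_eq_div, le_div_iff₀ (by positivity)]
    have h4 := one_le_psi (x + y)
    set s := psi x
    set t := psi (x + y)
    have h5 : t ^ 4 - s ^ 4 - (t - s) * (4 * s ^ 3)
        = (t - s) ^ 2 * (t ^ 2 + 2 * s * t + 3 * s ^ 2) := by ring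
    have h6 : 0 ≤ (t - s) ^ 2 * (t ^ 2 + 2 * s * t + 3 * s ^ 2) := by positivity
    linarith

theorem psi_add_le (x y : E d) : psi (x + y) ≤ psi x + ‖y‖ ^ (1 / 2 : ℝ) := by
  rw [← Real.sqrt_eq_rpow]
  unfold psi
  set S := √(1 + ‖x‖ ^ 2) with hS
  have hS0 : 0 ≤ S := Real.sqrt_nonneg _
  have hS2 : S ^ 2 = 1 + ‖x‖ ^ 2 := Real.sq_sqrt (by positivity)
  have hxS : ‖x‖ ≤ S := Real.le_sqrt_of_sq_le (by linarith)
  have h1 : √(1 + ‖x + y‖ ^ 2) ≤ S + ‖y‖ := by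
    rw [Real.sqrt_le_left (by positivity)]
    have h2 : ‖x + y‖ ^ 2 ≤ (‖x‖ + ‖y‖) ^ 2 := by gcongr; exact norm_add_le x y
    nlinarith [norm_nonneg x, norm_nonneg y]
  refine (Real.sqrt_le_sqrt h1).trans ?_
  rw [Real.sqrt_le_left (by positivity)]
  nlinarith [Real.sq_sqrt hS0, Real.sq_sqrt (norm_nonneg y), Real.sqrt_nonneg S,
    Real.sqrt_nonneg ‖y‖, mul_nonneg (Real.sqrt_nonneg S) (Real.sqrt_nonneg ‖y‖)]

theorem bump_near (x y : E d) :
    bump x - bump (x + y) ≤ bump x * (2 * inner ℝ x y + ‖y‖ ^ 2) := by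
  have h1 : bump (x + y) = bump x * Real.exp (-(2 * inner ℝ x y + ‖y‖ ^ 2)) := by
    unfold bump
    rw [← Real.exp_add, norm_add_sq_real]
    congr 1; ring
  have h2 := Real.add_one_le_exp (-(2 * inner ℝ x y + ‖y‖ ^ 2))
  rw [h1]
  nlinarith [bump_pos x]

/-- The constant in front of the bump in the lower bound for the kernels. -/
def lowC (d : ℕ) (lam : ℝ) : ℝ := lam * Real.exp (-((d : ℝ) + 1) ^ 2)

theorem lowC_pos {lam : ℝ} (hlam : 0 < lam) : 0 < lowC d lam := by unfold lowC; positivity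

theorem IsKer.lowC_bump_le {lam Lam : ℝ} (hlam : 0 < lam) {K : E d → ℝ} (hK : IsKer lam Lam K)
    {x y : E d} (hy : y ≠ 0) (hxy : ‖x + y‖ ≤ 1) : lowC d lam * bump x ≤ K y := by
  refine le_trans ?_ (hK.lower hy)
  unfold lowC bump
  rw [mul_assoc, ← Real.exp_add]
  refine mul_le_mul_of_nonneg_left ?_ hlam.le
  have hy0 : 0 < ‖y‖ := norm_pos_iff.2 hy
  have h1 : ‖y‖ ≤ 1 + ‖x‖ := by
    have : y = (x + y) - x := by abel
    calc ‖y‖ = ‖(x + y) - x‖ := by rw [← this]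
      _ ≤ ‖x + y‖ + ‖x‖ := norm_sub_le _ _
      _ ≤ 1 + ‖x‖ := by linarith
  have h2 : ‖y‖ ≤ Real.exp ‖x‖ := h1.trans (by linarith [Real.add_one_le_exp ‖x‖])
  have h3 : Real.log ‖y‖ ≤ ‖x‖ := (Real.log_le_iff_le_exp hy0).2 h2
  rw [Real.rpow_def_of_pos hy0, Real.exp_le_exp]
  have h4 : (0 : ℝ) ≤ (d : ℝ) + 1 := by positivity
  nlinarith [sq_nonneg (‖x‖ - ((d : ℝ) + 1)), mul_le_mul_of_nonneg_left h3 h4,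
    sq_nonneg ‖x‖, sq_nonneg ((d : ℝ) + 1)]

/-- The size of the kernels of the class `L₀` against `wt`. -/
def uppC (d : ℕ) (Lam : ℝ) : ℝ := Lam * ∫ y : E d, wt y

theorem uppC_nonneg {Lam : ℝ} (hLam : 0 < Lam) : 0 ≤ uppC d Lam :=
  mul_nonneg hLam.le (integral_nonneg wt_nonneg)

theorem IsKer.barrier_le (hd : 1 ≤ d) {lam Lam : ℝ} (hlam : 0 < lam) (hlL : lam ≤ Lam)
    {K : E d → ℝ} (hK : IsKer lam Lam K) {ρ : ℝ} (hρ : 0 < ρ) (hρ1 : ρ < 1) {ε m : ℝ}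
    (hε : 0 ≤ ε) (hm : 0 ≤ m) (x : E d) :
    IntegrableOn (fun y => (ε * (psi (x + y) - psi x) + m * (bump x - bump (x + y))) * K y)
      {y | ρ ≤ ‖y‖} ∧
    ∫ y in {y | ρ ≤ ‖y‖}, (ε * (psi (x + y) - psi x) + m * (bump x - bump (x + y))) * K y
      ≤ (ε + m * bump x) * uppC d Lam := by
  have hint : IntegrableOn
      (fun y => (ε * (psi (x + y) - psi x) + m * (bump x - bump (x + y))) * K y)
      {y | ρ ≤ ‖y‖} := by
    refine hK.integrableOn_far hd hlam hlL hρ (C := ε * psi x + m) ?_ ?_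
    · have h1 := (continuous_psi (d := d)).comp (continuous_const_add x)
      have h2 := (continuous_bump (d := d)).comp (continuous_const_add x)
      exact ((continuous_const.mul (h1.sub continuous_const)).add
        (continuous_const.mul (continuous_const.sub h2))).measurable
    · intro y
      have h6 : 0 ≤ ‖y‖ ^ (1 / 2 : ℝ) := by positivity
      have h1 := psi_add_le x y
      have h2 := one_le_psi x
      have h3 := one_le_psi (x + y)
      have h4 : |psi (x + y) - psi x| ≤ psi x * (1 + ‖y‖ ^ (1 / 2 : ℝ)) := by
        rw [abs_le]; constructor <;> nlinarith
      have h5 : |bump x - bump (x + y)| ≤ 1 * (1 + ‖y‖ ^ (1 / 2 : ℝ)) := by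
        have := bump_pos x
        have := bump_pos (x + y)
        have := bump_le_one x
        have := bump_le_one (x + y)
        rw [abs_le]; constructor <;> linarith
      calc |ε * (psi (x + y) - psi x) + m * (bump x - bump (x + y))|
          ≤ |ε * (psi (x + y) - psi x)| + |m * (bump x - bump (x + y))| := abs_add_le _ _
        _ = ε * |psi (x + y) - psi x| + m * |bump x - bump (x + y)| := by
            rw [abs_mul, abs_mul, abs_of_nonneg hε, abs_of_nonneg hm]
        _ ≤ ε * (psi x * (1 + ‖y‖ ^ (1 / 2 : ℝ))) + m * (1 * (1 + ‖y‖ ^ (1 / 2 : ℝ))) := by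
            gcongr
        _ = _ := by ring
  refine ⟨hint, ?_⟩
  obtain ⟨a, ha0, ha1, ha⟩ := psi_near x
  have hb := bump_pos x
  refine hK.setIntegral_le hd hlam hlL hρ hρ1 ((2 * (ε * a + m * bump x)) • innerSL ℝ x)
    (by positivity) hint ?_ ?_
  · intro y _
    have h1 := mul_le_mul_of_nonneg_left (ha y) hε
    have h2 := mul_le_mul_of_nonneg_left (bump_near x y) hm
    have h3 : ε * a * ‖y‖ ^ 2 ≤ ε * ‖y‖ ^ 2 := by
      nlinarith [mul_nonneg hε (sq_nonneg ‖y‖)]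
    simp only [smul_apply, innerSL_apply_apply, smul_eq_mul]
    linarith
  · intro y hy
    have h3 : 1 ≤ ‖y‖ ^ (1 / 2 : ℝ) := Real.one_le_rpow hy (by norm_num)
    have h1 := mul_le_mul_of_nonneg_left (psi_add_le x y) hε
    have h2 : bump x - bump (x + y) ≤ bump x * (2 * ‖y‖ ^ (1 / 2 : ℝ)) := by
      nlinarith [bump_pos (x + y)]
    have h4 := mul_le_mul_of_nonneg_left h2 hm
    have h5 : 0 ≤ ε * ‖y‖ ^ (1 / 2 : ℝ) := by positivity
    linarith

/-- The inequality satisfied by the truncated operator at a point where the barrier is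
touched. -/
theorem IsKer.contact_le (hd : 1 ≤ d) {lam Lam : ℝ} (hlam : 0 < lam) (hlL : lam ≤ Lam)
    {K : E d → ℝ} (hK : IsKer lam Lam K) {ρ : ℝ} (hρ : 0 < ρ) (hρ1 : ρ < 1) {ε m : ℝ}
    (hε : 0 ≤ ε) (hm : 0 ≤ m) {v : E d → ℝ} (hv : Continuous v)
    (hgrow : ∀ y, |v y| ≤ 1 + psi y) (hball : ∀ y, ‖y‖ ≤ 1 → |v y| ≤ 1) {x : E d}
    (hmax : ∀ y, v y - ε * psi y + m * bump y ≤ v x - ε * psi x + m * bump x)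
    (hpos : 1 ≤ v x - ε * psi x + m * bump x) :
    ∫ y in {y | ρ ≤ ‖y‖}, (v (x + y) - v x) * K y
      ≤ (ε + m * bump x) * uppC d Lam
        - lowC d lam * bump x * ((∫ y in closedBall (0 : E d) 1, (1 - v y))
            - m * volume.real (closedBall (0 : E d) 1))
        + 2 * lowC d lam * volume.real (ball (0 : E d) ρ) := by
  obtain ⟨hbi, hb⟩ := hK.barrier_le hd hlam hlL hρ hρ1 hε hm x
  set B := closedBall (0 : E d) 1 with hB
  have hBm : MeasurableSet B := measurableSet_closedBall
  have hc := lowC_pos (d := d) hlam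
  have hbx := bump_pos x
  have hvi : IntegrableOn (fun y => (v (x + y) - v x) * K y) {y | ρ ≤ ‖y‖} := by
    refine hK.integrableOn_far hd hlam hlL hρ (C := 2 + psi x + psi x)
      ((hv.comp (continuous_const_add x)).sub continuous_const).measurable ?_
    intro y
    have h6 : 0 ≤ ‖y‖ ^ (1 / 2 : ℝ) := by positivity
    have h1 := psi_add_le x y
    have h2 := one_le_psi x
    have h3 := abs_le.1 (hgrow (x + y))
    have h4 := abs_le.1 (hgrow x)
    have h5 := mul_nonneg h6 (zero_le_one.trans h2)
    rw [abs_le]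
    constructor <;> nlinarith
  set g : E d → ℝ := B.indicator (fun y => 1 - v y - m) with hg
  have hgi : Integrable g := by
    rw [hg, integrable_indicator_iff hBm]
    exact ((continuous_const.sub hv).sub continuous_const).continuousOn.integrableOn_compact
      (isCompact_closedBall _ _)
  have hgx : Integrable (fun y => g (x + y)) := hgi.comp_add_left x
  have hgle : ∀ y, g y ≤ 2 := by
    intro y
    by_cases hy : y ∈ B
    · simp only [hg, indicator_of_mem hy]
      have := abs_le.1 (hball y (by simpa [hB] using hy))
      linarith
    · simp only [hg, indicator_of_notMem hy]; norm_num
  have hgint : ∫ y, g y = (∫ y in B, (1 - v y)) - m * volume.real B := by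
    rw [hg, integral_indicator hBm, integral_sub]
    · simp [mul_comm]
    · exact (continuous_const.sub hv).continuousOn.integrableOn_compact (isCompact_closedBall _ _)
    · exact continuous_const.continuousOn.integrableOn_compact (isCompact_closedBall _ _)
  have hcompl : {y : E d | ρ ≤ ‖y‖}ᶜ = ball 0 ρ := by
    ext y; simp
  have hfar : (∫ y, g y) - 2 * volume.real (ball (0 : E d) ρ)
      ≤ ∫ y in {y | ρ ≤ ‖y‖}, g (x + y) := by
    have h1 := integral_add_compl (measurableSet_far ρ) hgx
    rw [integral_add_left_eq_self (μ := volume) g x, hcompl] at h1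
    have h2 : ∫ y in ball (0 : E d) ρ, g (x + y) ≤ ∫ y in ball (0 : E d) ρ, (2 : ℝ) :=
      setIntegral_mono hgx.integrableOn (integrableOn_const measure_ball_lt_top.ne)
        (fun y => hgle _)
    have h3 : ∫ y in ball (0 : E d) ρ, (2 : ℝ) = 2 * volume.real (ball (0 : E d) ρ) := by
      simp [mul_comm]
    linarith
  have hstep : ∫ y in {y | ρ ≤ ‖y‖}, (v (x + y) - v x) * K y
      ≤ ∫ y in {y | ρ ≤ ‖y‖},
        ((ε * (psi (x + y) - psi x) + m * (bump x - bump (x + y))) * K y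
          - lowC d lam * bump x * g (x + y)) := by
    refine setIntegral_mono_on hvi (hbi.sub (hgx.const_mul _).integrableOn)
      (measurableSet_far ρ) ?_
    intro y hy
    have hy0 := norm_pos_of_far hρ hy
    have hKn := hK.nonneg hlam hy0
    set br := (ε * (psi (x + y) - psi x) + m * (bump x - bump (x + y))) - (v (x + y) - v x)
      with hbr
    have hbr0 : 0 ≤ br := by have := hmax (x + y); rw [hbr]; linarith
    suffices h : lowC d lam * bump x * g (x + y) ≤ br * K y by
      rw [hbr] at h; linarith
    by_cases hxy : x + y ∈ B
    · have h1 := hK.lowC_bump_le hlam hy0 (x := x) (by simpa [hB] using hxy)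
      have h2 : g (x + y) ≤ br := by
        simp only [hg, indicator_of_mem hxy, hbr]
        have h3 := bump_le_one (x + y)
        have h4 := one_le_psi (x + y)
        nlinarith
      calc lowC d lam * bump x * g (x + y) ≤ lowC d lam * bump x * br := by gcongr
        _ ≤ K y * br := by gcongr
        _ = br * K y := mul_comm _ _
    · simp only [hg, indicator_of_notMem hxy, mul_zero]
      positivity
  rw [integral_sub hbi (hgx.const_mul _).integrableOn, integral_const_mul] at hstep
  rw [hgint] at hfar
  have h7 := mul_le_mul_of_nonneg_left hfar (by positivity : 0 ≤ lowC d lam * bump x)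
  have h8 : lowC d lam * bump x * (2 * volume.real (ball (0 : E d) ρ))
      ≤ lowC d lam * 1 * (2 * volume.real (ball (0 : E d) ρ)) := by
    gcongr
    exact bump_le_one x
  linarith

end Nonlocal

namespace Nonlocal

variable {d : ℕ}

/-- The function is a subsolution, up to `G`, of the extremal equation in `t ≤ 0`: the principal
values along some kernels of the class `L₀` bound the time derivative. -/
def IsSub (lam Lam G : ℝ) (w : ℝ × E d → ℝ) : Prop :=
  ∀ z : ℝ × E d, z.1 ≤ 0 → ∀ ε : ℝ, 0 < ε → ∃ K : E d → ℝ, IsKer lam Lam K ∧ ∃ ρ : ℝ, 0 < ρ ∧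
    ρ < ε ∧ ut w z ≤ (∫ y in {y | ρ ≤ ‖y‖}, (w (z.1, z.2 + y) - w z) * K y) + G + ε

/-- Continuity and time differentiability for `t ≤ 0`. -/
def Reg (w : ℝ × E d → ℝ) : Prop :=
  ∀ z : ℝ × E d, z.1 ≤ 0 → ContinuousAt w z ∧ DifferentiableAt ℝ (fun s => w (s, z.2)) z.1

/-- The integral of `1 - w` over the unit ball, extended by its final value to positive times. -/
def defect (w : ℝ × E d → ℝ) (s : ℝ) : ℝ := ∫ y in closedBall (0 : E d) 1, (1 - w (min s 0, y))

theorem Reg.continuous_clamp {w : ℝ × E d → ℝ} (hw : Reg w) :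
    Continuous (fun p : ℝ × E d => w (min p.1 0, p.2)) := by
  rw [continuous_iff_continuousAt]
  intro p
  have h1 : Continuous (fun p : ℝ × E d => (min p.1 0, p.2)) := by fun_prop
  exact ContinuousAt.comp (f := fun p : ℝ × E d => (min p.1 0, p.2))
    (hw (min p.1 0, p.2) (min_le_right _ _)).1 h1.continuousAt

theorem Reg.continuous_slice {w : ℝ × E d → ℝ} (hw : Reg w) {t : ℝ} (ht : t ≤ 0) :
    Continuous (fun y : E d => w (t, y)) := by
  have h := hw.continuous_clamp.comp (Continuous.prodMk_right t)
  simpa [Function.comp_def, ht] using h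

theorem Reg.continuous_defect {w : ℝ × E d → ℝ} (hw : Reg w) : Continuous (defect w) := by
  refine continuous_parametric_integral_of_continuous (f := fun s y => 1 - w (min s 0, y)) ?_
    (isCompact_closedBall (0 : E d) 1)
  exact continuous_const.sub hw.continuous_clamp

theorem volume_ball_le (hd : 1 ≤ d) {ρ : ℝ} (hρ : 0 ≤ ρ) (hρ1 : ρ ≤ 1) :
    volume.real (ball (0 : E d) ρ) ≤ ρ * volume.real (closedBall (0 : E d) 1) := by
  have := nontrivial_E hd
  have h1 : volume.real (ball (0 : E d) ρ) = ρ ^ d * volume.real (ball (0 : E d) 1) := by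
    simp only [measureReal_def]
    rw [Measure.addHaar_ball _ _ hρ, ENNReal.toReal_mul,
      ENNReal.toReal_ofReal (by positivity), finrank_euclideanSpace_fin]
  rw [h1]
  have h2 : volume.real (ball (0 : E d) 1) ≤ volume.real (closedBall (0 : E d) 1) :=
    measureReal_mono ball_subset_closedBall measure_closedBall_lt_top.ne
  have h3 : ρ ^ d ≤ ρ := pow_le_of_le_one hρ hρ1 (by omega)
  gcongr

theorem HasDerivAt.nonneg_of_le_left {g : ℝ → ℝ} {D a t : ℝ} (hg : HasDerivAt g D t) (hat : a < t)
    (hle : ∀ s, a ≤ s → s ≤ t → g s ≤ g t) : 0 ≤ D := by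
  have h := (hasDerivAt_iff_tendsto_slope_left_right.1 hg).1
  refine ge_of_tendsto h ?_
  filter_upwards [Ioo_mem_nhdsLT hat] with s hs
  rw [slope_def_field]
  exact div_nonneg_of_nonpos (by linarith [hle s hs.1.le hs.2.le]) (by linarith [hs.2])

/-- The damping rate of the time-dependent barrier. -/
def rate (d : ℕ) (lam Lam : ℝ) : ℝ :=
  uppC d Lam + lowC d lam * volume.real (closedBall (0 : E d) 1)

/-- The height of the time-dependent barrier. -/
def height (lam Lam : ℝ) (w : ℝ × E d → ℝ) (t : ℝ) : ℝ :=
  lowC d lam * (Real.exp (-rate d lam Lam * (t + 1)) * ∫ s in (-1 : ℝ)..t, defect w s)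

theorem Reg.hasDerivAt_height {w : ℝ × E d → ℝ} (hw : Reg w) (lam Lam t : ℝ) :
    HasDerivAt (height lam Lam w)
      (lowC d lam * Real.exp (-rate d lam Lam * (t + 1)) * defect w t
        - rate d lam Lam * height lam Lam w t) t := by
  have h1 : HasDerivAt (fun u => ∫ s in (-1 : ℝ)..u, defect w s) (defect w t) t :=
    intervalIntegral.integral_hasDerivAt_right (hw.continuous_defect.intervalIntegrable _ _)
      hw.continuous_defect.stronglyMeasurable.stronglyMeasurableAtFilter
      hw.continuous_defect.continuousAt
  have h2 : HasDerivAt (fun u : ℝ => Real.exp (-rate d lam Lam * (u + 1)))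
      (Real.exp (-rate d lam Lam * (t + 1)) * (-rate d lam Lam * 1)) t :=
    (((hasDerivAt_id t).add_const 1).const_mul (-rate d lam Lam)).exp
  refine ((h2.mul h1).const_mul (lowC d lam)).congr_deriv ?_
  unfold height
  ring

theorem defect_nonneg {w : ℝ × E d → ℝ}
    (hball : ∀ z : ℝ × E d, -1 ≤ z.1 → z.1 ≤ 0 → ‖z.2‖ ≤ 1 → |w z| ≤ 1) {s : ℝ} (hs : -1 ≤ s) :
    0 ≤ defect w s := by
  refine setIntegral_nonneg measurableSet_closedBall fun y hy => ?_
  have := hball (min s 0, y) (le_min hs (by norm_num)) (min_le_right _ _) (by simpa using hy)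
  linarith [(abs_le.1 this).2]

theorem barrier (hd : 1 ≤ d) {lam Lam : ℝ} (hlam : 0 < lam) (hlL : lam ≤ Lam) {ε : ℝ} (hε : 0 < ε)
    (hε1 : ε ≤ 1) {w : ℝ × E d → ℝ} (hw : Reg w) (hsub : IsSub lam Lam ε w)
    (hgrow : ∀ z : ℝ × E d, -1 ≤ z.1 → z.1 ≤ 0 → |w z| ≤ 1 + ε / 2 * psi z.2)
    (hball : ∀ z : ℝ × E d, -1 ≤ z.1 → z.1 ≤ 0 → ‖z.2‖ ≤ 1 → |w z| ≤ 1)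
    (z : ℝ × E d) (hz1 : -1 ≤ z.1) (hz0 : z.1 ≤ 0) :
    w z ≤ 1 + ε * psi z.2 + ε * (uppC d Lam + 3) * (z.1 + 1)
      - height lam Lam w z.1 * bump z.2 := by
  have hLam : 0 < Lam := by linarith
  have hc := lowC_pos (d := d) hlam
  have hC0 := uppC_nonneg (d := d) hLam
  have hV : 0 ≤ volume.real (closedBall (0 : E d) 1) := measureReal_nonneg
  have hht0 : ∀ t, -1 ≤ t → 0 ≤ height lam Lam w t := by
    intro t ht
    refine mul_nonneg hc.le (mul_nonneg (Real.exp_pos _).le ?_)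
    exact intervalIntegral.integral_nonneg ht fun s hs => defect_nonneg hball hs.1
  have hhtc : Continuous (height lam Lam w) :=
    continuous_iff_continuousAt.2 fun t => (hw.hasDerivAt_height lam Lam t).continuousAt
  set f : ℝ × E d → ℝ := fun z => w z - (1 + ε * psi z.2 + ε * (uppC d Lam + 3) * (z.1 + 1)
      - height lam Lam w z.1 * bump z.2) with hf
  by_contra! hcon
  have hfz : 0 < f z := by simp only [hf]; linarith
  obtain ⟨Mx, hMx⟩ := (isCompact_Icc (a := (-1 : ℝ)) (b := 0)).exists_bound_of_continuousOn
    hhtc.continuousOn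
  set R : ℝ := max ‖z.2‖ ((2 * Mx / ε) ^ 2) with hR
  have hout : ∀ p : ℝ × E d, -1 ≤ p.1 → p.1 ≤ 0 → R < ‖p.2‖ → f p ≤ 0 := by
    intro p hp1 hp0 hpR
    have h1 : 2 * Mx / ε ≤ psi p.2 := by
      refine le_trans ?_ (sqrt_norm_le_psi p.2)
      refine Real.le_sqrt_of_sq_le ((le_max_right _ _).trans hpR.le)
    rw [div_le_iff₀ hε] at h1
    have h2 := (abs_le.1 (hgrow p hp1 hp0)).2
    have h3 := (le_abs_self _).trans (hMx p.1 ⟨hp1, hp0⟩)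
    have h4 := hht0 p.1 hp1
    have h5 : height lam Lam w p.1 * bump p.2 ≤ height lam Lam w p.1 :=
      mul_le_of_le_one_right h4 (bump_le_one _)
    have h6 : 0 ≤ ε * (uppC d Lam + 3) * (p.1 + 1) := by
      have : 0 ≤ p.1 + 1 := by linarith
      positivity
    simp only [hf]
    linarith
  obtain ⟨⟨t, x⟩, hmS, hmax⟩ := ((isCompact_Icc (a := (-1 : ℝ)) (b := 0)).prod
    (isCompact_closedBall (0 : E d) R)).exists_isMaxOn (f := f)
    ⟨z, ⟨hz1, hz0⟩, by simp [hR]⟩ (by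
      intro p hp
      refine ContinuousAt.continuousWithinAt ?_
      have h1 := (hw p hp.1.2).1
      have h2 : Continuous (fun z : ℝ × E d => 1 + ε * psi z.2 + ε * (uppC d Lam + 3) * (z.1 + 1)
          - height lam Lam w z.1 * bump z.2) := by
        have h3 := (continuous_psi (d := d)).comp (continuous_snd (X := ℝ))
        have h4 := (continuous_bump (d := d)).comp (continuous_snd (X := ℝ))
        have h5 := hhtc.comp (continuous_fst (Y := E d))
        simp only [Function.comp_def] at h3 h4 h5
        fun_prop
      exact h1.sub h2.continuousAt)
  have ht1 : -1 ≤ t := hmS.1.1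
  have ht0 : t ≤ 0 := hmS.1.2
  have hfm : 0 < f (t, x) := hfz.trans_le (hmax ⟨⟨hz1, hz0⟩, by simp [hR]⟩)
  have hmax' : ∀ p : ℝ × E d, -1 ≤ p.1 → p.1 ≤ 0 → f p ≤ f (t, x) := by
    intro p hp1 hp0
    by_cases hpR : ‖p.2‖ ≤ R
    · exact hmax ⟨⟨hp1, hp0⟩, by simpa using hpR⟩
    · exact (hout p hp1 hp0 (not_le.1 hpR)).trans hfm.le
  have hm0 := hht0 t ht1
  have ht1' : -1 < t := by
    refine lt_of_le_of_ne ht1 fun h => ?_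
    have h2 := (abs_le.1 (hgrow (t, x) ht1 ht0)).2
    have h3 := one_le_psi x
    have h4 : 0 ≤ height lam Lam w t * bump x := mul_nonneg hm0 (bump_pos x).le
    have h5 : height lam Lam w t = 0 := by rw [← h]; simp [height]
    simp only [hf, h5] at hfm
    have h6 : t + 1 = 0 := by linarith
    simp only [h6] at hfm
    nlinarith
  set δ : ℝ := min (min (ε / 2) 1)
    (ε / (4 * lowC d lam * (volume.real (closedBall (0 : E d) 1) + 1))) with hδ
  have hδ0 : 0 < δ := by positivity
  obtain ⟨K, hK, ρ, hρ0, hρδ, hu⟩ := hsub (t, x) ht0 δ hδ0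
  have hδ1 : δ ≤ ε / 2 := (min_le_left _ _).trans (min_le_left _ _)
  have hδ2 : δ ≤ 1 := (min_le_left _ _).trans (min_le_right _ _)
  have hδ3 : δ * (4 * lowC d lam * (volume.real (closedBall (0 : E d) 1) + 1)) ≤ ε := by
    rw [← le_div_iff₀ (by positivity)]; exact min_le_right _ _
  have hder : HasDerivAt (fun s => f (s, x))
      (ut w (t, x) - (ε * (uppC d Lam + 3)
        - (lowC d lam * Real.exp (-rate d lam Lam * (t + 1)) * defect w t
        - rate d lam Lam * height lam Lam w t) * bump x)) t := by
    have h1 : HasDerivAt (fun s => w (s, x)) (ut w (t, x)) t := (hw (t, x) ht0).2.hasDerivAt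
    have h2 := (hw.hasDerivAt_height lam Lam t).mul_const (bump x)
    have h3 : HasDerivAt (fun s : ℝ => 1 + ε * psi x + ε * (uppC d Lam + 3) * (s + 1))
        (ε * (uppC d Lam + 3)) t := by
      simpa using (((hasDerivAt_id t).add_const 1).const_mul (ε * (uppC d Lam + 3))).const_add
        (1 + ε * psi x)
    exact h1.sub (h3.sub h2)
  have hD := HasDerivAt.nonneg_of_le_left hder ht1'
    (fun s hs1 hs2 => hmax' (s, x) hs1 (hs2.trans ht0))
  have hslice := hw.continuous_slice ht0
  have hcontact := hK.contact_le hd hlam hlL hρ0 (hρδ.trans_le hδ2) hε.le hm0 hslice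
    (fun y => (hgrow (t, y) ht1 ht0).trans (by nlinarith [one_le_psi y]))
    (fun y hy => hball (t, y) ht1 ht0 hy) (x := x)
    (fun y => by
      have := hmax' (t, y) ht1 ht0
      simp only [hf] at this
      linarith)
    (by
      have h6 : 0 ≤ ε * (uppC d Lam + 3) * (t + 1) := by
        have : 0 ≤ t + 1 := by linarith
        positivity
      simp only [hf] at hfm
      linarith)
  have hdef : ∫ y in closedBall (0 : E d) 1, (1 - w (t, y)) = defect w t := by
    simp [defect, ht0]
  rw [hdef] at hcontact
  have hI := defect_nonneg hball ht1
  have hexp : Real.exp (-rate d lam Lam * (t + 1)) ≤ 1 := by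
    rw [Real.exp_le_one_iff]
    have h1 : 0 ≤ rate d lam Lam := by unfold rate; positivity
    have h2 : 0 ≤ t + 1 := by linarith
    nlinarith [mul_nonneg h1 h2]
  have hb := bump_pos x
  have h10 : lowC d lam * Real.exp (-rate d lam Lam * (t + 1)) * defect w t * bump x
      ≤ lowC d lam * 1 * defect w t * bump x := by gcongr
  have h11 := volume_ball_le hd hρ0.le (hρδ.le.trans hδ2)
  have h12 : 2 * lowC d lam * volume.real (ball (0 : E d) ρ)
      ≤ 2 * lowC d lam * (δ * volume.real (closedBall (0 : E d) 1)) := by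
    gcongr
    exact h11.trans (by gcongr)
  have h13 : rate d lam Lam * height lam Lam w t * bump x
      = height lam Lam w t * bump x * uppC d Lam
        + lowC d lam * bump x * (height lam Lam w t * volume.real (closedBall (0 : E d) 1)) := by
    unfold rate; ring
  have h14 : 0 ≤ δ * lowC d lam := by positivity
  simp only at hu
  nlinarith

end Nonlocal

namespace Nonlocal

variable {d : ℕ}

theorem IsSub.mono {lam Lam G G' : ℝ} (hG : G ≤ G') {w : ℝ × E d → ℝ} (hw : IsSub lam Lam G w) :
    IsSub lam Lam G' w := by
  intro z hz ε hε
  obtain ⟨K, hK, ρ, h0, h1, h2⟩ := hw z hz ε hε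
  exact ⟨K, hK, ρ, h0, h1, by linarith⟩

theorem rate_nonneg {lam Lam : ℝ} (hlam : 0 < lam) (hlL : lam ≤ Lam) : 0 ≤ rate d lam Lam :=
  add_nonneg (uppC_nonneg (hlam.trans_le hlL))
    (mul_nonneg (lowC_pos hlam).le measureReal_nonneg)

/-- Geometric growth at a slow rate is dominated by the weight `psi`. -/
theorem abs_le_psi_of_growth {θ ε : ℝ} (hθ : 0 < θ) (hθ1 : θ ≤ 1 / 2) (hθε : θ ≤ ε / 32)
    (hε : ε ≤ 1) {w : ℝ × E d → ℝ}
    (hw : ∀ (j : ℕ) (z : ℝ × E d), z.1 ≤ 0 → ‖z‖ ≤ 4 ^ j → |w z| ≤ 2 * ((1 - θ)⁻¹) ^ j - 1)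
    (z : ℝ × E d) (hz1 : -1 ≤ z.1) (hz0 : z.1 ≤ 0) : |w z| ≤ 1 + ε / 2 * psi z.2 := by
  have hε0 : 0 < ε := by linarith
  have hq : (1 - θ)⁻¹ ≤ 1 + ε / 16 := by
    rw [inv_le_iff_one_le_mul₀ (by linarith)]
    nlinarith
  have hq0 : 0 ≤ (1 - θ)⁻¹ := inv_nonneg.2 (by linarith)
  have hpow : ∀ j : ℕ, ((1 - θ)⁻¹) ^ j ≤ 1 + ε / 8 * 2 ^ j := by
    intro j
    induction j with
    | zero => simp; linarith
    | succ k ih =>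
      have h2 : (1 : ℝ) ≤ 2 ^ k := one_le_pow₀ (by norm_num)
      calc ((1 - θ)⁻¹) ^ (k + 1) = ((1 - θ)⁻¹) ^ k * (1 - θ)⁻¹ := pow_succ _ _
        _ ≤ (1 + ε / 8 * 2 ^ k) * (1 + ε / 16) := by gcongr
        _ ≤ 1 + ε / 8 * 2 ^ (k + 1) := by
          rw [pow_succ]
          nlinarith [mul_le_mul_of_nonneg_left hε (by positivity : 0 ≤ ε * 2 ^ k),
            mul_le_mul_of_nonneg_left h2 hε0.le]
  have hpsi := one_le_psi z.2
  have hz1' : ‖z.1‖ ≤ 1 := by rw [Real.norm_eq_abs, abs_le]; constructor <;> linarith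
  rcases le_or_gt ‖z.2‖ 1 with h | h
  · have h1 := hw 0 z hz0 (by simpa using (norm_prod_le_iff.2 ⟨hz1', h⟩ : ‖z‖ ≤ 1))
    simp only [pow_zero] at h1
    nlinarith
  · obtain ⟨n, hn1, hn2⟩ := exists_nat_pow_near h.le (by norm_num : (1 : ℝ) < 4)
    have h4 : (1 : ℝ) ≤ 4 ^ (n + 1) := one_le_pow₀ (by norm_num)
    have h1 := hw (n + 1) z hz0 (norm_prod_le_iff.2 ⟨hz1'.trans h4, hn2.le⟩)
    have h2 := hpow (n + 1)
    have h3 : (2 : ℝ) ^ n ≤ psi z.2 := by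
      refine le_trans ?_ (sqrt_norm_le_psi z.2)
      refine Real.le_sqrt_of_sq_le ?_
      rw [← pow_mul, mul_comm, pow_mul]
      norm_num
      exact hn1
    rw [pow_succ (2 : ℝ)] at h2
    have h5 := mul_le_mul_of_nonneg_left h3 hε0.le
    linarith

/-- The guaranteed decrease of a subsolution whose defect is at least half of the maximal one. -/
def drop (d : ℕ) (lam Lam : ℝ) : ℝ :=
  lowC d lam * (Real.exp (-rate d lam Lam) *
    (3 / 4 * volume.real (closedBall (0 : E d) 1))) * Real.exp (-1)

theorem volume_closedBall_pos : 0 < volume.real (closedBall (0 : E d) 1) :=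
  ENNReal.toReal_pos (measure_closedBall_pos _ _ one_pos).ne' measure_closedBall_lt_top.ne

theorem drop_pos {lam : ℝ} (hlam : 0 < lam) (Lam : ℝ) : 0 < drop d lam Lam := by
  have := lowC_pos (d := d) hlam
  have := volume_closedBall_pos (d := d)
  unfold drop
  positivity

theorem le_of_defect (hd : 1 ≤ d) {lam Lam : ℝ} (hlam : 0 < lam) (hlL : lam ≤ Lam) {ε : ℝ}
    (hε : 0 < ε) (hε1 : ε ≤ 1) {w : ℝ × E d → ℝ} (hw : Reg w) (hsub : IsSub lam Lam ε w)
    (hgrow : ∀ z : ℝ × E d, -1 ≤ z.1 → z.1 ≤ 0 → |w z| ≤ 1 + ε / 2 * psi z.2)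
    (hball : ∀ z : ℝ × E d, -1 ≤ z.1 → z.1 ≤ 0 → ‖z.2‖ ≤ 1 → |w z| ≤ 1)
    (hdef : 3 / 4 * volume.real (closedBall (0 : E d) 1)
      ≤ ∫ s in (-1 : ℝ)..(-1 / 4), defect w s)
    (z : ℝ × E d) (hz0 : z.1 ≤ 0) (hz : ‖z‖ ≤ 1 / 4) :
    w z ≤ 1 + ε * (uppC d Lam + 5) - drop d lam Lam := by
  obtain ⟨hzt, hzx⟩ := norm_prod_le_iff.1 hz
  rw [Real.norm_eq_abs, abs_le] at hzt
  have hb := barrier hd hlam hlL hε hε1 hw hsub hgrow hball z (by linarith [hzt.1]) hz0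
  have hU : 0 ≤ uppC d Lam := uppC_nonneg (hlam.trans_le hlL)
  have hL := lowC_pos (d := d) hlam
  have hr := rate_nonneg (d := d) hlam hlL
  have hpsi := psi_le_two (x := z.2) (by linarith)
  have h1 : ε * psi z.2 ≤ ε * 2 := by gcongr
  have h2 : ε * (uppC d Lam + 3) * (z.1 + 1) ≤ ε * (uppC d Lam + 3) * 1 := by
    gcongr; linarith
  have hI : 3 / 4 * volume.real (closedBall (0 : E d) 1) ≤ ∫ s in (-1 : ℝ)..z.1, defect w s := by
    refine hdef.trans ?_
    have hii := fun a b => hw.continuous_defect.intervalIntegrable (μ := volume) a b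
    rw [← intervalIntegral.integral_add_adjacent_intervals (hii (-1) (-1 / 4)) (hii _ z.1)]
    have : 0 ≤ ∫ s in (-1 / 4 : ℝ)..z.1, defect w s :=
      intervalIntegral.integral_nonneg (by linarith [hzt.1]) fun s hs =>
        defect_nonneg hball (by linarith [hs.1])
    linarith
  have hexp : Real.exp (-rate d lam Lam) ≤ Real.exp (-rate d lam Lam * (z.1 + 1)) := by
    rw [Real.exp_le_exp]; nlinarith
  have hbump : Real.exp (-1) ≤ bump z.2 := by
    unfold bump
    rw [Real.exp_le_exp]
    nlinarith [norm_nonneg z.2]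
  have hV := volume_closedBall_pos (d := d)
  have h3 : drop d lam Lam ≤ height lam Lam w z.1 * bump z.2 := by
    unfold drop height
    have h0 : 0 ≤ ∫ s in (-1 : ℝ)..z.1, defect w s := le_trans (by positivity) hI
    gcongr
  linarith

theorem Reg.neg {w : ℝ × E d → ℝ} (hw : Reg w) : Reg (fun z => -w z) :=
  fun z hz => ⟨(hw z hz).1.neg, (hw z hz).2.neg⟩

theorem Reg.defect_add_defect_neg {w : ℝ × E d → ℝ} (hw : Reg w) (s : ℝ) :
    defect w s + defect (fun z => -w z) s = 2 * volume.real (closedBall (0 : E d) 1) := by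
  have hc : Continuous (fun y : E d => w (min s 0, y)) := hw.continuous_slice (min_le_right _ _)
  have h1 : IntegrableOn (fun y : E d => 1 - w (min s 0, y)) (closedBall 0 1) :=
    (continuous_const.sub hc).continuousOn.integrableOn_compact (isCompact_closedBall _ _)
  have h2 : IntegrableOn (fun y : E d => 1 - -w (min s 0, y)) (closedBall 0 1) :=
    (continuous_const.sub hc.neg).continuousOn.integrableOn_compact (isCompact_closedBall _ _)
  unfold defect
  rw [← integral_add h1 h2]
  have : ∀ y : E d, 1 - w (min s 0, y) + (1 - -w (min s 0, y)) = 2 := fun y => by ring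
  simp only [this, setIntegral_const, smul_eq_mul]
  ring

theorem exists_oneStep (hd : 1 ≤ d) {lam Lam : ℝ} (hlam : 0 < lam) (hlL : lam ≤ Lam) :
    ∃ θ ε : ℝ, 0 < θ ∧ θ ≤ 1 / 2 ∧ 0 < ε ∧ ∀ w : ℝ × E d → ℝ, Reg w → IsSub lam Lam ε w →
      IsSub lam Lam ε (fun z => -w z) →
      (∀ (j : ℕ) (z : ℝ × E d), z.1 ≤ 0 → ‖z‖ ≤ 4 ^ j → |w z| ≤ 2 * ((1 - θ)⁻¹) ^ j - 1) →
      (∀ z : ℝ × E d, z.1 ≤ 0 → ‖z‖ ≤ 1 / 4 → w z ≤ 1 - 2 * θ) ∨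
        (∀ z : ℝ × E d, z.1 ≤ 0 → ‖z‖ ≤ 1 / 4 → -(1 - 2 * θ) ≤ w z) := by
  set μ := drop d lam Lam with hμ
  have hμ0 : 0 < μ := drop_pos hlam Lam
  have hU : 0 ≤ uppC d Lam := uppC_nonneg (hlam.trans_le hlL)
  set ε := min 1 (μ / 2 / (uppC d Lam + 5)) with hεdef
  have hε : 0 < ε := lt_min one_pos (by positivity)
  have hε1 : ε ≤ 1 := min_le_left _ _
  have hεμ : ε * (uppC d Lam + 5) ≤ μ / 2 := by
    rw [← le_div_iff₀ (by positivity)]; exact min_le_right _ _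
  set θ := min (1 / 2) (min (μ / 4) (ε / 32)) with hθdef
  have hθ : 0 < θ := by positivity
  have hθ1 : θ ≤ 1 / 2 := min_le_left _ _
  have hθμ : θ ≤ μ / 4 := (min_le_right _ _).trans (min_le_left _ _)
  have hθε : θ ≤ ε / 32 := (min_le_right _ _).trans (min_le_right _ _)
  refine ⟨θ, ε, hθ, hθ1, hε, fun w hw hs hs' hg => ?_⟩
  have hgrow := abs_le_psi_of_growth hθ hθ1 hθε hε1 hg
  have hball : ∀ z : ℝ × E d, -1 ≤ z.1 → z.1 ≤ 0 → ‖z.2‖ ≤ 1 → |w z| ≤ 1 := by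
    intro z hz1 hz0 hz
    have hz1' : ‖z.1‖ ≤ 1 := by rw [Real.norm_eq_abs, abs_le]; constructor <;> linarith
    have h1 := hg 0 z hz0 (by simpa using (norm_prod_le_iff.2 ⟨hz1', hz⟩ : ‖z‖ ≤ 1))
    simp only [pow_zero] at h1
    linarith
  have hsum : (∫ s in (-1 : ℝ)..(-1 / 4), defect w s)
      + ∫ s in (-1 : ℝ)..(-1 / 4), defect (fun z => -w z) s
      = 2 * (3 / 4 * volume.real (closedBall (0 : E d) 1)) := by
    rw [← intervalIntegral.integral_add (hw.continuous_defect.intervalIntegrable _ _)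
      (hw.neg.continuous_defect.intervalIntegrable _ _)]
    simp only [hw.defect_add_defect_neg, intervalIntegral.integral_const, smul_eq_mul]
    ring
  rcases le_or_gt (3 / 4 * volume.real (closedBall (0 : E d) 1))
    (∫ s in (-1 : ℝ)..(-1 / 4), defect w s) with h | h
  · left
    intro z hz0 hz
    have := le_of_defect hd hlam hlL hε hε1 hw hs hgrow hball h z hz0 hz
    linarith
  · right
    intro z hz0 hz
    have := le_of_defect hd hlam hlL hε hε1 hw.neg hs' (by simpa only [abs_neg] using hgrow)
      (by simpa only [abs_neg] using hball) (by linarith) z hz0 hz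
    linarith

end Nonlocal

namespace Nonlocal

open scoped Pointwise

variable {d : ℕ}

theorem smul_far {r ρ : ℝ} (hr : 0 < r) : r • {y : E d | ρ / r ≤ ‖y‖} = {y | ρ ≤ ‖y‖} := by
  ext y
  rw [mem_smul_set_iff_inv_smul_mem₀ hr.ne']
  simp only [mem_ofPred_eq, norm_smul, norm_inv, Real.norm_eq_abs, abs_of_pos hr]
  rw [inv_mul_eq_div, div_le_div_iff_of_pos_right hr]

theorem IsKer.scale {lam Lam : ℝ} {K : E d → ℝ} (hK : IsKer lam Lam K) {r : ℝ} (hr : 0 < r) :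
    IsKer lam Lam (fun y => r ^ (d + 1) * K (r • y)) := by
  refine ⟨(hK.1.comp (measurable_const_smul r)).const_mul _, ?_, fun _ => ?_⟩
  · intro y hy
    have hry : r • y ≠ 0 := smul_ne_zero hr.ne' hy
    have h := hK.2.1 (r • y) hry
    have e : ‖r • y‖ ^ (-((d : ℝ) + 1)) = (r ^ (d + 1))⁻¹ * ‖y‖ ^ (-((d : ℝ) + 1)) := by
      rw [norm_smul, Real.norm_eq_abs, abs_of_pos hr, Real.mul_rpow hr.le (norm_nonneg _),
        Real.rpow_neg hr.le]
      norm_cast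
    rw [e] at h
    have hp : 0 < r ^ (d + 1) := by positivity
    have h1 := mul_le_mul_of_nonneg_left h.1 hp.le
    have h2 := mul_le_mul_of_nonneg_left h.2 hp.le
    field_simp at h1 h2 ⊢
    exact ⟨h1, h2⟩
  · intro r₁ r₂ h1 h2
    have h := hK.2.2 rfl (r * r₁) (r * r₂) (by positivity) (by gcongr)
    have hs : r • {y : E d | r₁ ≤ ‖y‖ ∧ ‖y‖ ≤ r₂} = {y | r * r₁ ≤ ‖y‖ ∧ ‖y‖ ≤ r * r₂} := by
      ext y
      rw [mem_smul_set_iff_inv_smul_mem₀ hr.ne']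
      simp only [mem_ofPred_eq, norm_smul, norm_inv, Real.norm_eq_abs, abs_of_pos hr]
      rw [le_inv_mul_iff₀ hr, inv_mul_le_iff₀ hr]
    have e : ∀ y : E d, (r ^ (d + 1) * K (r • y)) • y = r ^ d • (K (r • y) • (r • y)) := by
      intro y
      simp only [smul_smul]
      congr 1
      ring
    simp only [e]
    rw [integral_smul, Measure.setIntegral_comp_smul_of_pos volume (fun y => K y • y) _ hr, hs, h,
      smul_zero, smul_zero]

theorem Reg.scale {w : ℝ × E d → ℝ} (hw : Reg w) {r : ℝ} (hr : 0 < r) (c A : ℝ) :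
    Reg (fun z => (w (r * z.1, r • z.2) - c) / A) := by
  intro z hz
  obtain ⟨h1, h2⟩ := hw (r * z.1, r • z.2) (by simpa using mul_nonpos_of_nonneg_of_nonpos hr.le hz)
  constructor
  · have h3 : ContinuousAt (fun z : ℝ × E d => (r * z.1, r • z.2)) z := by fun_prop
    exact ((ContinuousAt.comp (f := fun z : ℝ × E d => (r * z.1, r • z.2)) h1 h3).sub
      continuousAt_const).div_const A
  · have h3 : DifferentiableAt ℝ (fun s : ℝ => r * s) z.1 := by fun_prop
    exact ((DifferentiableAt.comp (f := fun s : ℝ => r * s) z.1 h2 h3).sub_const c).div_const A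

theorem IsSub.scale {lam Lam G : ℝ} {w : ℝ × E d → ℝ} (hw : IsSub lam Lam G w) {r A : ℝ}
    (hr : 0 < r) (hA : 0 < A) (c : ℝ) :
    IsSub lam Lam (r * G / A) (fun z => (w (r * z.1, r • z.2) - c) / A) := by
  intro z hz ε hε
  obtain ⟨K, hK, ρ, hρ, hρε, hle⟩ := hw (r * z.1, r • z.2)
    (by simpa using mul_nonpos_of_nonneg_of_nonpos hr.le hz) (min (r * ε) (A * ε / r))
    (by positivity)
  refine ⟨_, hK.scale hr, ρ / r, by positivity, ?_, ?_⟩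
  · rw [div_lt_iff₀' hr]
    exact hρε.trans_le (min_le_left _ _)
  · have hut : ut (fun z => (w (r * z.1, r • z.2) - c) / A) z
        = r / A * ut w (r * z.1, r • z.2) := by
      unfold ut
      rw [deriv_div_const, deriv_sub_const,
        deriv_comp_mul_left r (fun s => w (s, r • z.2)), smul_eq_mul]
      ring
    have hint : ∫ y in {y : E d | ρ / r ≤ ‖y‖}, ((w (r * z.1, r • (z.2 + y)) - c) / A
          - (w (r * z.1, r • z.2) - c) / A) * (r ^ (d + 1) * K (r • y))
        = r / A * ∫ y in {y : E d | ρ ≤ ‖y‖},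
            (w (r * z.1, r • z.2 + y) - w (r * z.1, r • z.2)) * K y := by
      have e : ∀ y : E d, ((w (r * z.1, r • (z.2 + y)) - c) / A
          - (w (r * z.1, r • z.2) - c) / A) * (r ^ (d + 1) * K (r • y))
          = (r ^ (d + 1) / A) * ((w (r * z.1, r • z.2 + r • y) - w (r * z.1, r • z.2))
            * K (r • y)) := by
        intro y
        rw [smul_add]
        ring
      simp only [e]
      rw [integral_const_mul, Measure.setIntegral_comp_smul_of_pos volume
        (fun y => (w (r * z.1, r • z.2 + y) - w (r * z.1, r • z.2)) * K y) _ hr, smul_far hr,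
        finrank_euclideanSpace_fin, smul_eq_mul]
      field_simp
      rw [pow_succ]
    rw [hut, hint]
    have h1 := mul_le_mul_of_nonneg_left hle (by positivity : 0 ≤ r / A)
    have h2 : r / A * min (r * ε) (A * ε / r) ≤ ε := by
      calc r / A * min (r * ε) (A * ε / r) ≤ r / A * (A * ε / r) := by
            gcongr; exact min_le_right _ _
        _ = ε := by field_simp
    simp only at h1
    have h3 : r / A * G = r * G / A := by ring
    linarith

/-- Iterating the one-step decay of oscillation over the scales `4 ^ (-k)`. -/
theorem oscillation_decay {lam Lam θ ε : ℝ} (hθ : 0 < θ) (hθ1 : θ ≤ 1 / 2)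
    (hstep : ∀ w : ℝ × E d → ℝ, Reg w → IsSub lam Lam ε w → IsSub lam Lam ε (fun z => -w z) →
      (∀ (j : ℕ) (z : ℝ × E d), z.1 ≤ 0 → ‖z‖ ≤ 4 ^ j → |w z| ≤ 2 * ((1 - θ)⁻¹) ^ j - 1) →
      (∀ z : ℝ × E d, z.1 ≤ 0 → ‖z‖ ≤ 1 / 4 → w z ≤ 1 - 2 * θ) ∨
        (∀ z : ℝ × E d, z.1 ≤ 0 → ‖z‖ ≤ 1 / 4 → -(1 - 2 * θ) ≤ w z))
    {w : ℝ × E d → ℝ} (hw : Reg w) {G : ℝ} (hG : 0 ≤ G) (hs : IsSub lam Lam G w)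
    (hs' : IsSub lam Lam G (fun z => -w z)) {r A : ℝ} (hr : 0 < r) (hA : 0 < A)
    (hGA : r * G / A ≤ ε) {c₀ : ℝ}
    (h0 : ∀ (j : ℕ) (z : ℝ × E d), z.1 ≤ 0 → ‖z‖ ≤ 4 ^ j * r →
      |w z - c₀| ≤ A * (2 * ((1 - θ)⁻¹) ^ j - 1)) (k : ℕ) :
    ∃ c : ℝ, ∀ (j : ℕ) (z : ℝ × E d), z.1 ≤ 0 → ‖z‖ ≤ 4 ^ j * (r / 4 ^ k) →
      |w z - c| ≤ A * (1 - θ) ^ k * (2 * ((1 - θ)⁻¹) ^ j - 1) := by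
  have hq : 0 < 1 - θ := by linarith
  induction k with
  | zero => exact ⟨c₀, by simpa using h0⟩
  | succ k ih =>
    obtain ⟨c, hc⟩ := ih
    set R := r / 4 ^ k with hR
    set B := A * (1 - θ) ^ k with hB
    have hR0 : 0 < R := by positivity
    have hB0 : 0 < B := by positivity
    have hR4 : r / 4 ^ (k + 1) = R / 4 := by rw [hR, pow_succ]; field_simp
    have hB4 : A * (1 - θ) ^ (k + 1) = B * (1 - θ) := by rw [hB, pow_succ]; ring
    have hGB : R * G / B ≤ ε := by
      refine le_trans ?_ hGA
      have h1 : (1 : ℝ) ≤ 4 ^ k * (1 - θ) ^ k := by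
        rw [← mul_pow]
        exact one_le_pow₀ (by linarith)
      have h2 : R * G / B = r * G / A / (4 ^ k * (1 - θ) ^ k) := by
        rw [hR, hB]; field_simp
      rw [h2]
      exact div_le_self (by positivity) h1
    have hsmul : ∀ z : ℝ × E d, ‖((R * z.1, R • z.2) : ℝ × E d)‖ = R * ‖z‖ := by
      intro z
      have : ((R * z.1, R • z.2) : ℝ × E d) = R • z := rfl
      rw [this, norm_smul, Real.norm_eq_abs, abs_of_pos hR0]
    have key := hstep (fun z => (w (R * z.1, R • z.2) - c) / B) (hw.scale hR0 c B)
      ((hs.scale hR0 hB0 c).mono hGB)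
      (by
        have := (hs'.scale hR0 hB0 (-c)).mono hGB
        convert this using 2 with z
        ring)
      (by
        intro j z hz hzj
        rw [abs_div, abs_of_pos hB0, div_le_iff₀' hB0]
        refine hc j _ (by simpa using mul_nonpos_of_nonneg_of_nonpos hR0.le hz) ?_
        rw [hsmul, mul_comm]
        gcongr)
    have hback : ∀ z : ℝ × E d, z.1 ≤ 0 → ‖z‖ ≤ R / 4 → ∃ z' : ℝ × E d, z'.1 ≤ 0 ∧ ‖z'‖ ≤ 1 / 4 ∧
        (R * z'.1, R • z'.2) = z := by
      intro z hz hzn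
      refine ⟨R⁻¹ • z, ?_, ?_, ?_⟩
      · simpa using mul_nonpos_of_nonneg_of_nonpos (inv_pos.2 hR0).le hz
      · rw [norm_smul, norm_inv, Real.norm_eq_abs, abs_of_pos hR0, inv_mul_le_iff₀ hR0]
        linarith
      · ext1
        · simp [hR0.ne']
        · simp [smul_smul, hR0.ne']
    have hfar : ∀ c' : ℝ, |c' - c| ≤ θ * B → ∀ (j : ℕ) (z : ℝ × E d), z.1 ≤ 0 →
        ‖z‖ ≤ 4 ^ (j + 1) * (R / 4) →
        |w z - c'| ≤ B * (1 - θ) * (2 * ((1 - θ)⁻¹) ^ (j + 1) - 1) := by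
      intro c' hc' j z hz hzn
      have h1 := hc j z hz (by rw [pow_succ] at hzn; linarith)
      have h2 : |w z - c'| ≤ |w z - c| + |c' - c| := by
        have : w z - c' = (w z - c) - (c' - c) := by ring
        rw [this]; exact abs_sub _ _
      have h3 : B * (1 - θ) * (2 * ((1 - θ)⁻¹) ^ (j + 1) - 1)
          = B * (2 * ((1 - θ)⁻¹) ^ j - 1) + θ * B := by
        rw [pow_succ]; field_simp; ring
      linarith
    rw [hR4, hB4]
    rcases key with key | key
    · refine ⟨c - θ * B, fun j => ?_⟩
      cases j with
      | zero =>
        intro z hz hzn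
        simp only [pow_zero, one_mul] at hzn
        obtain ⟨z', hz', hzn', rfl⟩ := hback z hz hzn
        have h1 := key z' hz' hzn'
        rw [div_le_iff₀ hB0] at h1
        have h2 := (abs_le.1 (hc 0 _ hz (by simp only [pow_zero, one_mul]; linarith))).1
        simp only [pow_zero] at h2 ⊢
        rw [abs_le]
        constructor <;> linarith
      | succ j =>
        exact hfar _ (by rw [sub_sub_cancel_left, abs_neg, abs_of_pos (by positivity)]) j
    · refine ⟨c + θ * B, fun j => ?_⟩
      cases j with
      | zero =>
        intro z hz hzn
        simp only [pow_zero, one_mul] at hzn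
        obtain ⟨z', hz', hzn', rfl⟩ := hback z hz hzn
        have h1 := key z' hz' hzn'
        rw [le_div_iff₀ hB0] at h1
        have h2 := (abs_le.1 (hc 0 _ hz (by simp only [pow_zero, one_mul]; linarith))).2
        simp only [pow_zero] at h2 ⊢
        rw [abs_le]
        constructor <;> linarith
      | succ j =>
        exact hfar _ (by rw [add_sub_cancel_left, abs_of_pos (by positivity)]) j

end Nonlocal

namespace Nonlocal

open Filter Topology

variable {d : ℕ}

theorem isOpen_lowerHalf : IsOpen (lowerHalf d) := isOpen_Iio.prod isOpen_univ

theorem mem_lowerHalf {z : ℝ × E d} : z ∈ lowerHalf d ↔ z.1 < 0 := by simp [lowerHalf]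

theorem ae_ne_zero (hd : 1 ≤ d) : ∀ᵐ y : E d, y ≠ 0 := by
  have := nontrivial_E hd
  exact compl_mem_ae_iff.2 (measure_singleton (0 : E d))

theorem IsKer.abs_mul_le {lam Lam : ℝ} (hlam : 0 < lam) {K : E d → ℝ} (hK : IsKer lam Lam K) {y : E d}
    (hy : y ≠ 0) (a : ℝ) : |a * K y| ≤ Lam * |a * ‖y‖ ^ (-((d : ℝ) + 1))| := by
  have h : 0 ≤ ‖y‖ ^ (-((d : ℝ) + 1)) := by positivity
  rw [abs_mul, abs_mul, abs_of_nonneg (hK.nonneg hlam hy), abs_of_nonneg h]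
  calc |a| * K y ≤ |a| * (Lam * ‖y‖ ^ (-((d : ℝ) + 1))) := by gcongr; exact hK.upper hy
    _ = _ := by ring

theorem IsKer.integrable_mul (hd : 1 ≤ d) {lam Lam : ℝ} (hlam : 0 < lam) {K : E d → ℝ}
    (hK : IsKer lam Lam K) {g : E d → ℝ}
    (hg : Integrable (fun y => g y * ‖y‖ ^ (-((d : ℝ) + 1)))) :
    Integrable (fun y => g y * K y) := by
  have e : (fun y => g y * ‖y‖ ^ (-((d : ℝ) + 1)) * (‖y‖ ^ ((d : ℝ) + 1) * K y))
      =ᵐ[volume] fun y => g y * K y := by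
    filter_upwards [ae_ne_zero hd] with y hy
    have hy0 : 0 < ‖y‖ := norm_pos_iff.2 hy
    rw [Real.rpow_neg hy0.le]
    field_simp
  refine Integrable.mono' (hg.abs.const_mul Lam) ?_ ?_
  · refine AEStronglyMeasurable.congr (hg.aestronglyMeasurable.mul ?_) e
    exact ((measurable_norm.pow_const _).mul hK.1).aestronglyMeasurable
  · filter_upwards [ae_ne_zero hd] with y hy
    exact hK.abs_mul_le hlam hy _

theorem IsKer.le_Lop (hd : 1 ≤ d) {lam Lam : ℝ} (hlam : 0 < lam) {K : E d → ℝ}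
    (hK : IsKer lam Lam K) {u : ℝ × E d → ℝ} {z : ℝ × E d}
    (hg : Integrable (fun y => deltaU 1 u z.1 z.2 y * ‖y‖ ^ (-((d : ℝ) + 1)))) :
    -(∫ y, Lam * |deltaU 1 u z.1 z.2 y * ‖y‖ ^ (-((d : ℝ) + 1))|) ≤ Lop 1 K u z := by
  unfold Lop
  rw [← integral_neg]
  refine integral_mono_ae (hg.abs.const_mul Lam).neg (hK.integrable_mul hd hlam hg) ?_
  filter_upwards [ae_ne_zero hd] with y hy
  exact (abs_le.1 (hK.abs_mul_le hlam hy _)).1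

theorem tendsto_setIntegral_far (hd : 1 ≤ d) {g : E d → ℝ} (hg : Integrable g) :
    Tendsto (fun n : ℕ => ∫ y in {y : E d | 1 / ((n : ℝ) + 1) ≤ ‖y‖}, g y) atTop
      (𝓝 (∫ y, g y)) := by
  have hU : (⋃ n : ℕ, {y : E d | 1 / ((n : ℝ) + 1) ≤ ‖y‖}) = {0}ᶜ := by
    ext y
    simp only [mem_iUnion, mem_ofPred_eq, mem_compl_iff, mem_singleton_iff]
    constructor
    · rintro ⟨n, hn⟩
      exact norm_pos_of_far (by positivity) hn
    · intro hy
      obtain ⟨n, hn⟩ := exists_nat_one_div_lt (norm_pos_iff.2 hy)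
      exact ⟨n, hn.le⟩
  have h := tendsto_setIntegral_of_monotone (μ := volume) (f := g)
    (s := fun n : ℕ => {y : E d | 1 / ((n : ℝ) + 1) ≤ ‖y‖}) (fun n => measurableSet_far _)
    (fun m n hmn y hy => by
      simp only [mem_ofPred_eq] at hy ⊢
      refine le_trans ?_ hy
      gcongr) hg.integrableOn
  rw [hU] at h
  have e : ∫ y in ({0}ᶜ : Set (E d)), g y = ∫ y, g y :=
    setIntegral_eq_integral_of_ae_compl_eq_zero (by
      filter_upwards [ae_ne_zero hd] with y hy h
      exact absurd (mem_compl_singleton_iff.2 hy) h)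
  rwa [e] at h

theorem reg_translate_sub {u : ℝ × E d → ℝ} (hu : ContDiffOn ℝ (⊤ : ℕ∞) u (lowerHalf d))
    {P Q : ℝ × E d} (hP : P ∈ lowerHalf d) (hQ : Q ∈ lowerHalf d) :
    Reg (fun k => u (P + k) - u (Q + k)) := by
  have h : ∀ P ∈ lowerHalf d, ∀ z : ℝ × E d, z.1 ≤ 0 → DifferentiableAt ℝ (fun k => u (P + k)) z := by
    intro P hP z hz
    have hm : P + z ∈ lowerHalf d := by
      rw [mem_lowerHalf] at hP ⊢
      simp only [Prod.fst_add]
      linarith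
    have h1 : DifferentiableAt ℝ u (P + z) :=
      (hu.contDiffAt (isOpen_lowerHalf.mem_nhds hm)).differentiableAt (by simp)
    exact DifferentiableAt.comp (f := fun k => P + k) z h1 (by fun_prop)
  intro z hz
  have h1 := (h P hP z hz).sub (h Q hQ z hz)
  refine ⟨h1.continuousAt, ?_⟩
  exact DifferentiableAt.comp (f := fun s : ℝ => (s, z.2)) z.1 h1 (by fun_prop)

theorem isSub_translate_sub (hd : 1 ≤ d) {lam Lam : ℝ} (hlam : 0 < lam) (hlL : lam ≤ Lam)
    {ι : Type} [Nonempty ι] {K : ι → E d → ℝ} {f : ι → ℝ × E d → ℝ} {u : ℝ × E d → ℝ}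
    (hK : ∀ a, IsKer lam Lam (K a)) {F : ℝ} (hf : ∀ a, ∀ z ∈ lowerHalf d, |f a z| ≤ F)
    (hu : ContDiffOn ℝ (⊤ : ℕ∞) u (lowerHalf d))
    (hint : ∀ z ∈ lowerHalf d,
      Integrable (fun y : E d => deltaU 1 u z.1 z.2 y * ‖y‖ ^ (-((d : ℝ) + 1))))
    (heq : ∀ z ∈ lowerHalf d, ut u z = ⨅ a, (Lop 1 (K a) u z + f a z))
    {P Q : ℝ × E d} (hP : P ∈ lowerHalf d) (hQ : Q ∈ lowerHalf d) :
    IsSub lam Lam (2 * F) (fun k => u (P + k) - u (Q + k)) := by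
  intro z hz ε hε
  have hmem : ∀ P ∈ lowerHalf d, P + z ∈ lowerHalf d := by
    intro P hP
    rw [mem_lowerHalf] at hP ⊢
    simp only [Prod.fst_add]
    linarith
  have hp := hmem P hP
  have hq := hmem Q hQ
  obtain ⟨a, ha⟩ := exists_lt_of_ciInf_lt
    (show (⨅ a, (Lop 1 (K a) u (Q + z) + f a (Q + z))) < ut u (Q + z) + ε / 2 by
      rw [← heq _ hq]; linarith)
  have hbdd : BddBelow (range fun a => Lop 1 (K a) u (P + z) + f a (P + z)) := by
    refine ⟨-(∫ y, Lam * |deltaU 1 u (P + z).1 (P + z).2 y * ‖y‖ ^ (-((d : ℝ) + 1))|) + -F, ?_⟩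
    rintro _ ⟨b, rfl⟩
    exact add_le_add ((hK b).le_Lop hd hlam (hint _ hp)) (abs_le.1 (hf b _ hp)).1
  have hb : ut u (P + z) ≤ Lop 1 (K a) u (P + z) + f a (P + z) := by
    rw [heq _ hp]
    exact ciInf_le hbdd a
  have hut : ut (fun k => u (P + k) - u (Q + k)) z = ut u (P + z) - ut u (Q + z) := by
    have hslice : ∀ P : ℝ × E d, P + z ∈ lowerHalf d →
        DifferentiableAt ℝ (fun s => u (P + (s, z.2))) z.1 ∧
          deriv (fun s => u (P + (s, z.2))) z.1 = ut u (P + z) := by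
      intro P hm
      constructor
      · have h1 : DifferentiableAt ℝ u (P + (z.1, z.2)) :=
          (hu.contDiffAt (isOpen_lowerHalf.mem_nhds hm)).differentiableAt (by simp)
        exact DifferentiableAt.comp (f := fun s : ℝ => P + (s, z.2)) z.1 h1 (by fun_prop)
      · exact deriv_comp_const_add (fun s => u (s, P.2 + z.2)) P.1 z.1
    unfold ut
    rw [deriv_fun_sub (hslice P hp).1 (hslice Q hq).1, (hslice P hp).2, (hslice Q hq).2]
    rfl
  have hip := (hK a).integrable_mul hd hlam (hint _ hp)
  have hiq := (hK a).integrable_mul hd hlam (hint _ hq)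
  have hlim := tendsto_setIntegral_far hd (hip.sub hiq)
  have hLop : ∫ y, ((fun y => deltaU 1 u (P + z).1 (P + z).2 y * K a y)
      - fun y => deltaU 1 u (Q + z).1 (Q + z).2 y * K a y) y
      = Lop 1 (K a) u (P + z) - Lop 1 (K a) u (Q + z) := integral_sub hip hiq
  rw [hLop] at hlim
  have hlt : Lop 1 (K a) u (P + z) - Lop 1 (K a) u (Q + z) - ε / 2
      < Lop 1 (K a) u (P + z) - Lop 1 (K a) u (Q + z) := by linarith
  obtain ⟨n, hn1, hn2⟩ := ((hlim.eventually (lt_mem_nhds hlt)).and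
    ((tendsto_one_div_add_atTop_nhds_zero_nat (𝕜 := ℝ)).eventually
      (gt_mem_nhds (lt_min hε one_pos)))).exists
  refine ⟨K a, hK a, 1 / ((n : ℝ) + 1), by positivity, hn2.trans_le (min_le_left _ _), ?_⟩
  obtain ⟨hai, ha0⟩ := (hK a).annulus hd hlam hlL (ρ := 1 / ((n : ℝ) + 1)) (by positivity)
    (hn2.trans_le (min_le_right _ _)) (Du u (P + z) - Du u (Q + z))
  have hsplit : ∫ y in {y : E d | 1 / ((n : ℝ) + 1) ≤ ‖y‖},
      (u (P + (z.1, z.2 + y)) - u (Q + (z.1, z.2 + y)) - (u (P + z) - u (Q + z))) * K a y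
      = ∫ y in {y : E d | 1 / ((n : ℝ) + 1) ≤ ‖y‖},
        ((fun y => deltaU 1 u (P + z).1 (P + z).2 y * K a y)
          - fun y => deltaU 1 u (Q + z).1 (Q + z).2 y * K a y) y := by
    rw [← add_zero (∫ y in {y : E d | 1 / ((n : ℝ) + 1) ≤ ‖y‖},
        ((fun y => deltaU 1 u (P + z).1 (P + z).2 y * K a y)
          - fun y => deltaU 1 u (Q + z).1 (Q + z).2 y * K a y) y), ← ha0,
      ← integral_add (hip.sub hiq).integrableOn hai]
    refine integral_congr_ae (Eventually.of_forall fun y => ?_)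
    have e : ∀ P : ℝ × E d, u (P + (z.1, z.2 + y)) = u ((P + z).1, (P + z).2 + y) := by
      intro P
      congr 1
      ext1
      · rfl
      · exact (add_assoc _ _ _).symm
    simp only [e, Pi.sub_apply, deltaU, lt_irrefl, if_false, if_true, Prod.mk.eta]
    split_ifs
    · rw [sub_apply]; ring
    · ring
  simp only
  rw [hsplit, hut]
  have h1 := (abs_le.1 (hf a _ hp)).2
  have h2 := (abs_le.1 (hf a _ hq)).1
  linarith

end Nonlocal

namespace Nonlocal

open Filter Topology

variable {d : ℕ}

/-- The mixed increment of a Zygmund function grows at most logarithmically. -/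
theorem abs_mixed_le {u : ℝ × E d → ℝ} {N : ℝ}
    (hu : ∀ z h : ℝ × E d, z + h ∈ lowerHalf d → z - h ∈ lowerHalf d →
      |u (z + h) + u (z - h) - 2 * u z| ≤ N * ‖h‖)
    (hN : 0 ≤ N) {z : ℝ × E d} (hz : z ∈ lowerHalf d) {k : ℝ × E d} (hk : k.1 ≤ 0) (n : ℕ) :
    ∀ h : ℝ × E d, h.1 ≤ 0 → ‖k‖ ≤ 2 ^ n * ‖h‖ →
      |u (z + h + k) - u (z + k) - (u (z + h) - u z)| ≤ N * ‖h‖ * (n + 2) := by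
  rw [mem_lowerHalf] at hz
  have hmem : ∀ v : ℝ × E d, v.1 ≤ 0 → z + v ∈ lowerHalf d := by
    intro v hv
    rw [mem_lowerHalf, Prod.fst_add]
    linarith
  induction n with
  | zero =>
    intro h hh hkh
    simp only [pow_zero, one_mul] at hkh
    have two : ((1 / 2 : ℝ) + 1 / 2) = 1 := by norm_num
    have e1 : z + (1 / 2 : ℝ) • (h + k) + (1 / 2 : ℝ) • (h + k) = z + h + k := by
      rw [add_assoc, ← add_smul, two, one_smul, add_assoc]
    have e2 : z + (1 / 2 : ℝ) • (h + k) - (1 / 2 : ℝ) • (h + k) = z := add_sub_cancel_right _ _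
    have e3 : z + (1 / 2 : ℝ) • (h + k) + (1 / 2 : ℝ) • (h - k) = z + h := by module
    have e4 : z + (1 / 2 : ℝ) • (h + k) - (1 / 2 : ℝ) • (h - k) = z + k := by module
    have h1 := hu (z + (1 / 2 : ℝ) • (h + k)) ((1 / 2 : ℝ) • (h + k))
      (by rw [e1, add_assoc]; exact hmem _ (by simp only [Prod.fst_add]; linarith))
      (by rw [e2]; simpa using hmem 0 le_rfl)
    have h2 := hu (z + (1 / 2 : ℝ) • (h + k)) ((1 / 2 : ℝ) • (h - k))
      (by rw [e3]; exact hmem _ hh) (by rw [e4]; exact hmem _ hk)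
    rw [e1, e2, norm_smul] at h1
    rw [e3, e4, norm_smul] at h2
    have h3 : ‖(1 / 2 : ℝ)‖ = 1 / 2 := by norm_num
    rw [h3] at h1 h2
    have h4 : N * (1 / 2 * ‖h + k‖) ≤ N * (1 / 2 * (‖h‖ + ‖h‖)) := by
      gcongr
      exact (norm_add_le h k).trans (by linarith)
    have h5 : N * (1 / 2 * ‖h - k‖) ≤ N * (1 / 2 * (‖h‖ + ‖h‖)) := by
      gcongr
      exact (norm_sub_le h k).trans (by linarith)
    rw [abs_le] at h1 h2 ⊢
    push_cast
    constructor <;> linarith [h1.1, h1.2, h2.1, h2.2]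
  | succ n ih =>
    intro h hh hkh
    have hn2 : ‖(2 : ℝ) • h‖ = 2 * ‖h‖ := by rw [norm_smul]; norm_num
    have h2h : ((2 : ℝ) • h).1 ≤ 0 := by
      simp only [Prod.smul_fst, smul_eq_mul]; linarith
    have h0 := ih ((2 : ℝ) • h) h2h (by rw [hn2, ← mul_assoc, ← pow_succ]; exact hkh)
    have e1 : z + h + h = z + (2 : ℝ) • h := by module
    have e2 : z + h - h = z := add_sub_cancel_right _ _
    have e3 : z + h + k + h = z + (2 : ℝ) • h + k := by module
    have e4 : z + h + k - h = z + k := by module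
    have h1 := hu (z + h) h (by rw [e1]; exact hmem _ h2h)
      (by rw [e2]; simpa using hmem 0 le_rfl)
    have h2 := hu (z + h + k) h
      (by rw [e3, add_assoc]; exact hmem _ (by simp only [Prod.fst_add]; linarith))
      (by rw [e4]; exact hmem _ hk)
    rw [e1, e2] at h1
    rw [e3, e4] at h2
    rw [hn2] at h0
    rw [abs_le] at h0 h1 h2 ⊢
    push_cast
    constructor <;> linarith [h0.1, h0.2, h1.1, h1.2, h2.1, h2.2]

/-- Decay of oscillation of the increments, started at a large scale, bounds second differences. -/
theorem abs_second_difference_le {lam Lam θ ε : ℝ} (hθ : 0 < θ) (hθ1 : θ ≤ 1 / 2) (hε : 0 < ε)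
    (hstep : ∀ w : ℝ × E d → ℝ, Reg w → IsSub lam Lam ε w → IsSub lam Lam ε (fun z => -w z) →
      (∀ (j : ℕ) (z : ℝ × E d), z.1 ≤ 0 → ‖z‖ ≤ 4 ^ j → |w z| ≤ 2 * ((1 - θ)⁻¹) ^ j - 1) →
      (∀ z : ℝ × E d, z.1 ≤ 0 → ‖z‖ ≤ 1 / 4 → w z ≤ 1 - 2 * θ) ∨
        (∀ z : ℝ × E d, z.1 ≤ 0 → ‖z‖ ≤ 1 / 4 → -(1 - 2 * θ) ≤ w z))
    {u : ℝ × E d → ℝ} {N G : ℝ} (hN : 0 < N) (hG : 0 ≤ G)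
    (hu : ∀ z h : ℝ × E d, z + h ∈ lowerHalf d → z - h ∈ lowerHalf d →
      |u (z + h) + u (z - h) - 2 * u z| ≤ N * ‖h‖)
    (hreg : ∀ P ∈ lowerHalf d, ∀ Q ∈ lowerHalf d, Reg (fun k => u (P + k) - u (Q + k)))
    (hsub : ∀ P ∈ lowerHalf d, ∀ Q ∈ lowerHalf d,
      IsSub lam Lam G (fun k => u (P + k) - u (Q + k)))
    (m : ℕ) {z h : ℝ × E d} (hz : z ∈ lowerHalf d) (hh : h.1 ≤ 0) (hh0 : h ≠ 0) :
    |u (z + h + h) + u z - 2 * u (z + h)|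
      ≤ ‖h‖ * (N * (4 * (m + 1) * (1 - θ) ^ m / θ) + 2 * 4 ^ m * G / ε) := by
  have hhn : 0 < ‖h‖ := norm_pos_iff.2 hh0
  have hzh : z + h ∈ lowerHalf d := by
    rw [mem_lowerHalf] at hz ⊢
    rw [Prod.fst_add]
    linarith
  set A := ‖h‖ * (N * (2 * m + 2) / θ + 4 ^ m * G / ε) with hA
  have hA0 : 0 < A := by positivity
  have hAN : ‖h‖ * N * (2 * m + 2) ≤ A * θ := by
    have : A * θ = ‖h‖ * N * (2 * m + 2) + ‖h‖ * (4 ^ m * G / ε) * θ := by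
      rw [hA]; field_simp
    rw [this]
    have : 0 ≤ ‖h‖ * (4 ^ m * G / ε) * θ := by positivity
    linarith
  have hAG : 4 ^ m * ‖h‖ * G / A ≤ ε := by
    rw [div_le_iff₀ hA0]
    have : ε * A = 4 ^ m * ‖h‖ * G + ε * (‖h‖ * (N * (2 * m + 2) / θ)) := by
      rw [hA]; field_simp; ring
    rw [this]
    have : 0 ≤ ε * (‖h‖ * (N * (2 * m + 2) / θ)) := by positivity
    linarith
  obtain ⟨c, hc⟩ := oscillation_decay hθ hθ1 hstep (hreg _ hzh _ hz) hG (hsub _ hzh _ hz)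
    (by simpa only [neg_sub] using hsub _ hz _ hzh) (r := 4 ^ m * ‖h‖) (by positivity) hA0 hAG
    (c₀ := u (z + h) - u z) (by
      intro j k hk hkn
      have h1 := abs_mixed_le hu hN.le hz hk (2 * (j + m)) h hh (by
        rw [pow_mul, pow_add, mul_assoc]
        norm_num
        exact hkn)
      refine h1.trans ?_
      have hq : 1 + (j : ℝ) * θ ≤ ((1 - θ)⁻¹) ^ j := by
        refine (one_add_mul_le_pow (by linarith) j).trans ?_
        gcongr
        rw [← one_div, le_div_iff₀ (by linarith)]
        nlinarith
      have h2 : A * (2 * (1 + (j : ℝ) * θ) - 1) ≤ A * (2 * ((1 - θ)⁻¹) ^ j - 1) := by gcongr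
      refine le_trans ?_ h2
      have h3 : ‖h‖ * N * (2 * m + 2) ≤ A := by nlinarith
      have h4 := mul_le_mul_of_nonneg_left hAN (by positivity : (0 : ℝ) ≤ 2 * j)
      have h5 : 0 ≤ ‖h‖ * N * j * (4 * m + 2) := by positivity
      push_cast
      linarith) m
  have hr : (4 : ℝ) ^ m * ‖h‖ / 4 ^ m = ‖h‖ := by field_simp
  rw [hr] at hc
  have h1 := hc 0 h hh (by simp)
  have h2 := hc 0 0 le_rfl (by simp)
  simp only [pow_zero, add_zero] at h1 h2
  have hq1 : (1 - θ) ^ m ≤ 1 := pow_le_one₀ (by linarith) (by linarith)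
  have h3 : 2 * (A * (1 - θ) ^ m)
      ≤ ‖h‖ * (N * (4 * (m + 1) * (1 - θ) ^ m / θ) + 2 * 4 ^ m * G / ε) := by
    have e : 2 * (A * (1 - θ) ^ m) = ‖h‖ * (N * (4 * (m + 1) * (1 - θ) ^ m / θ)
        + 2 * 4 ^ m * G / ε * (1 - θ) ^ m) := by rw [hA]; ring
    rw [e]
    have : 2 * 4 ^ m * G / ε * (1 - θ) ^ m ≤ 2 * 4 ^ m * G / ε * 1 := by gcongr
    gcongr
    linarith
  rw [abs_le] at h1 h2 ⊢
  constructor <;> linarith [h1.1, h1.2, h2.1, h2.2]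

theorem abs_second_difference_le_of_zygFull {u : ℝ × E d → ℝ}
    (hu : zygFull (lowerHalf d) u < ⊤) (z h : ℝ × E d) (h1 : z + h ∈ lowerHalf d)
    (h2 : z - h ∈ lowerHalf d) :
    |u (z + h) + u (z - h) - 2 * u z| ≤ (zygFull (lowerHalf d) u).toReal * ‖h‖ := by
  rcases eq_or_ne h 0 with rfl | hh
  · simp [two_mul]
  · have hz : z ∈ lowerHalf d := by
      rw [mem_lowerHalf] at *
      simp only [Prod.fst_add, Prod.fst_sub] at h1 h2
      linarith
    rw [← div_le_iff₀ (norm_pos_iff.2 hh), ← ENNReal.ofReal_le_iff_le_toReal hu.ne]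
    exact le_iSup_of_le z (le_iSup_of_le h (le_iSup_of_le hh (le_iSup_of_le hz
      (le_iSup_of_le h1 (le_iSup_of_le h2 le_rfl)))))

theorem zygFull_le {u : ℝ × E d → ℝ} {B : ℝ}
    (hB : ∀ z h : ℝ × E d, z ∈ lowerHalf d → h.1 ≤ 0 → h ≠ 0 →
      |u (z + h + h) + u z - 2 * u (z + h)| ≤ ‖h‖ * B) :
    zygFull (lowerHalf d) u ≤ ENNReal.ofReal B := by
  refine iSup_le fun z => iSup_le fun h => iSup_le fun hh => iSup_le fun _ => iSup_le fun h1 =>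
    iSup_le fun h2 => ENNReal.ofReal_le_ofReal ?_
  rw [div_le_iff₀' (norm_pos_iff.2 hh)]
  rcases le_total h.1 0 with h0 | h0
  · have := hB (z - h) h h2 h0 hh
    rwa [sub_add_cancel] at this
  · have := hB (z + h) (-h) h1 (by simpa using h0) (neg_ne_zero.2 hh)
    rw [add_neg_cancel_right, norm_neg, ← sub_eq_add_neg] at this
    rwa [add_comm (u (z + h))]

theorem exists_small_pow {θ : ℝ} (hθ : 0 < θ) (hθ1 : θ ≤ 1 / 2) :
    ∃ m : ℕ, 4 * ((m : ℝ) + 1) * (1 - θ) ^ m / θ ≤ 1 / 2 := by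
  have hq : |1 - θ| < 1 := by rw [abs_lt]; constructor <;> linarith
  have h1 := tendsto_pow_const_mul_const_pow_of_abs_lt_one 1 hq
  have h0 := tendsto_pow_const_mul_const_pow_of_abs_lt_one 0 hq
  have h := ((h1.add h0).const_mul (4 / θ))
  rw [add_zero, mul_zero] at h
  obtain ⟨m, hm⟩ := (h.eventually (gt_mem_nhds (by norm_num : (0 : ℝ) < 1 / 2))).exists
  refine ⟨m, le_trans (le_of_eq ?_) hm.le⟩
  simp only [pow_one, pow_zero]
  ring

end Nonlocal

/-- Theorem 1.2 (ii), case σ = 1: global Zygmund estimate in `(t,x)` for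
translation invariant equations with merely bounded data. -/
theorem statement3 (d : ℕ) (hd : 1 ≤ d) (lam Lam : ℝ)
    (hlam : 0 < lam) (hlL : lam ≤ Lam) :
    ∃ C : ℝ, 0 < C ∧
      ∀ (ι : Type) (_ : Nonempty ι) (K : ι → E d → ℝ) (f : ι → ℝ × E d → ℝ)
        (u : ℝ × E d → ℝ),
        -- kernels in L₀ (σ = 1), independent of (t,x), with the cancellation condition
        (∀ a, memL0 1 lam Lam (K a)) →
        (∀ a, Measurable (K a)) →
        -- sup_a ‖f_a‖_{L∞(ℝ₀^{d+1})} < ∞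
        (⨆ a, supENorm (lowerHalf d) (f a)) < ⊤ →
        -- u is smooth on ℝ₀^{d+1}
        ContDiffOn ℝ (⊤ : ℕ∞) u (lowerHalf d) →
        -- δu(t,x,·) is integrable against |y|^{-d-1}
        (∀ z ∈ lowerHalf d,
          Integrable (fun y : E d =>
            deltaU 1 u z.1 z.2 y * ‖y‖ ^ (-((d : ℝ) + 1)))) →
        -- the equation u_t = inf_a (L_a u + f_a) in ℝ₀^{d+1}
        (∀ z ∈ lowerHalf d, ut u z = ⨅ a, (Lop 1 (K a) u z + f a z)) →
        -- finiteness of the space-time Zygmund seminorm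
        zygFull (lowerHalf d) u < ⊤ →
        zygFull (lowerHalf d) u
          ≤ ENNReal.ofReal C * ⨆ a, supENorm (lowerHalf d) (f a) := by
  obtain ⟨θ, ε, hθ, hθ1, hε, hstep⟩ := exists_oneStep hd hlam hlL
  obtain ⟨m, hm⟩ := exists_small_pow hθ hθ1
  refine ⟨8 * 4 ^ m / ε, by positivity, ?_⟩
  intro ι hι K f u hK hKm hf hu hint heq hzyg
  set S := ⨆ a, supENorm (lowerHalf d) (f a) with hS
  set Z := zygFull (lowerHalf d) u with hZ
  have hfF : ∀ a, ∀ z ∈ lowerHalf d, |f a z| ≤ S.toReal := by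
    intro a z hz
    rw [← ENNReal.ofReal_le_iff_le_toReal hf.ne]
    exact (le_iSup (fun p : lowerHalf d => ENNReal.ofReal ‖f a p.1‖) ⟨z, hz⟩).trans
      (le_iSup (fun a => supENorm (lowerHalf d) (f a)) a)
  have hF0 : 0 ≤ S.toReal := ENNReal.toReal_nonneg
  rw [← ENNReal.ofReal_toReal hf.ne, ← ENNReal.ofReal_mul (by positivity),
    ENNReal.le_ofReal_iff_toReal_le hzyg.ne (by positivity)]
  rcases (ENNReal.toReal_nonneg : 0 ≤ Z.toReal).eq_or_lt with hN | hN
  · rw [← hN]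
    positivity
  have hKer : ∀ a, IsKer lam Lam (K a) := fun a => ⟨hKm a, hK a⟩
  have hle : Z ≤ ENNReal.ofReal (Z.toReal * (4 * ((m : ℝ) + 1) * (1 - θ) ^ m / θ)
      + 2 * 4 ^ m * (2 * S.toReal) / ε) :=
    zygFull_le fun z h hz hh hh0 =>
      abs_second_difference_le hθ hθ1 hε hstep hN (by positivity)
        (abs_second_difference_le_of_zygFull hzyg) (fun P hP Q hQ => reg_translate_sub hu hP hQ)
        (fun P hP Q hQ => isSub_translate_sub hd hlam hlL hKer hfF hu hint heq hP hQ) m hz hh hh0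
  have hq : 0 < 1 - θ := by linarith
  rw [ENNReal.le_ofReal_iff_toReal_le hzyg.ne (by positivity)] at hle
  have h1 := mul_le_mul_of_nonneg_left hm hN.le
  have h2 : 2 * 4 ^ m * (2 * S.toReal) / ε = 8 * 4 ^ m / ε * S.toReal / 2 := by ring
  linarith
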